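/- Let p_c(n) denote the number of connected positroids on [n] (so p_c(1) = 2 and p_c(2) = 1). Then for every n ≥ 3, p_c(n) = (n−1)·p_c(n−1) + Σ_{j=2}^{n−2} (j−1)·p_c(j)·p_c(n−j), and lim_{n→∞} p_c(n)/n! = 1/e. -/

import Mathlib

open Finset

/-- A full-row-rank real `d × n` matrix is *totally nonnegative* if all of its
maximal (`d × d`) minors are nonnegative.  Columns are indexed by a finite
linearly ordered set `E`; a maximal minor is indexed by a strictly increasing
choice of `d` columns. -/
def Matrix.TotallyNonneg {d : ℕ} {E : Type*} [Fintype E] [LinearOrder E]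
    (A : Matrix (Fin d) E ℝ) : Prop :=
  A.rank = d ∧ ∀ f : Fin d → E, StrictMono f → 0 ≤ (A.submatrix id f).det

/-- `ℬ` is the collection of bases of the column matroid `M(A)`: the `d`-element
sets of column indices whose columns are linearly independent. -/
def Matrix.RepresentsBases {d : ℕ} {E : Type*} [Fintype E]
    (A : Matrix (Fin d) E ℝ) (ℬ : Finset E → Prop) : Prop :=
  ∀ B : Finset E, ℬ B ↔ B.card = d ∧ LinearIndependent ℝ (fun j : B => fun i => A i j.1)

/-- A positroid of rank `d` on the finite linearly ordered ground set `E`,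
given by its collection of bases `ℬ`. -/
def IsPositroidOfRank (d : ℕ) {E : Type*} [Fintype E] [LinearOrder E]
    (ℬ : Finset E → Prop) : Prop :=
  ∃ A : Matrix (Fin d) E ℝ, A.TotallyNonneg ∧ A.RepresentsBases ℬ

/-- A positroid on the finite linearly ordered ground set `E`. -/
def IsPositroid {E : Type*} [Fintype E] [LinearOrder E] (ℬ : Finset E → Prop) : Prop :=
  ∃ d, IsPositroidOfRank d ℬ


/-- The basis-exchange axiom: `ℬ` is the (nonempty) collection of bases of a
matroid on the ground set `E`. -/
def IsBasesSet {E : Type*} [DecidableEq E] (ℬ : Finset E → Prop) : Prop :=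
  (∃ B, ℬ B) ∧
  ∀ ⦃B₁ B₂ : Finset E⦄, ℬ B₁ → ℬ B₂ → ∀ b₁ ∈ B₁ \ B₂,
    ∃ b₂ ∈ B₂ \ B₁, ℬ (insert b₂ (B₁.erase b₁))

/-- Lexicographic order on two `d`-element subsets of `Fin n` (with respect to
the standard order): comparing the increasing enumerations `s_1 < ... < s_d`
and `t_1 < ... < t_d`, either they agree or they first differ at an index `k`
where `s_k < t_k`. -/
def LexLE {n : ℕ} (d : ℕ) (S T : Finset (Fin n)) : Prop :=
  ∃ (hS : S.card = d) (hT : T.card = d),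
    S = T ∨ ∃ k : Fin d,
      (∀ l, l < k → ((S.orderIsoOfFin hS) l : Fin n) = ((T.orderIsoOfFin hT) l : Fin n)) ∧
      ((S.orderIsoOfFin hS) k : Fin n) < ((T.orderIsoOfFin hT) k : Fin n)

/-- Gale order on two `d`-element subsets of `Fin n` (with respect to the
standard order): the increasing enumerations satisfy `s_k ≤ t_k` for all `k`. -/
def GaleLE {n : ℕ} (d : ℕ) (S T : Finset (Fin n)) : Prop :=
  ∃ (hS : S.card = d) (hT : T.card = d),
    ∀ k : Fin d, ((S.orderIsoOfFin hS) k : Fin n) ≤ ((T.orderIsoOfFin hT) k : Fin n)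

/-- Transfer of a basis collection supported on a subset `S ⊆ Fin n` to a basis
collection on the ground set `S` itself (a subtype carrying the inherited
order). -/
def toSubtypePred {n : ℕ} (S : Finset (Fin n)) (ℬ : Finset (Fin n) → Prop) :
    Finset {x : Fin n // x ∈ S} → Prop :=
  fun C => ℬ (C.map (Function.Embedding.subtype fun x => x ∈ S))

/-- A matroid (given by its basis collection `ℬ` on the ground set `E`) is
*connected* if it cannot be written as the direct sum of two matroids on
nonempty ground sets. -/
def MatroidConnected {E : Type*} [Fintype E] [DecidableEq E] (ℬ : Finset E → Prop) : Prop :=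
  ¬ ∃ (E₁ E₂ : Finset E) (ℬ₁ ℬ₂ : Finset E → Prop),
      E₁.Nonempty ∧ E₂.Nonempty ∧ Disjoint E₁ E₂ ∧ E₁ ∪ E₂ = Finset.univ ∧
      IsBasesSet ℬ₁ ∧ IsBasesSet ℬ₂ ∧
      (∀ B, ℬ₁ B → B ⊆ E₁) ∧ (∀ B, ℬ₂ B → B ⊆ E₂) ∧
      (∀ B, ℬ B ↔ ∃ B₁ B₂, ℬ₁ B₁ ∧ ℬ₂ B₂ ∧ B = B₁ ∪ B₂)

/-- `a, b, c, d` are (distinct and) in cyclic order in `Fin m`. -/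
def Cyc4 {m : ℕ} (a b c d : Fin m) : Prop :=
  0 < (b - a).val ∧ (b - a).val < (c - a).val ∧ (c - a).val < (d - a).val

/-- The number of connected positroids on `[n]`, each positroid identified with
its (finite) collection of bases. -/
noncomputable def numConnPositroids (n : ℕ) : ℕ :=
  Nat.card {ℬ : Finset (Finset (Fin n)) //
    IsPositroid (fun B => B ∈ ℬ) ∧ MatroidConnected (fun B => B ∈ ℬ)}

namespace Pos

/-- The columns of a matrix. -/
def cols {d n : ℕ} (A : Matrix (Fin d) (Fin n) ℝ) : Fin n → Fin d → ℝ := fun j i => A i j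

/-- The minor with a prescribed (ordered) choice of columns. -/
noncomputable def dt {d n : ℕ} (A : Matrix (Fin d) (Fin n) ℝ) (f : Fin d → Fin n) : ℝ :=
  (A.submatrix id f).det

/-- A Vandermonde determinant recording the sign of an ordered choice of columns. -/
noncomputable def vd {d n : ℕ} (f : Fin d → Fin n) : ℝ :=
  (Matrix.vandermonde (fun i => ((f i : ℕ) : ℝ))).det

lemma vd_nonneg {d n : ℕ} (f : Fin d → Fin n) (hf : StrictMono f) : 0 ≤ vd f := by
  unfold vd
  rw [Matrix.det_vandermonde]
  refine Finset.prod_nonneg fun i _ => Finset.prod_nonneg fun j hj => ?_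
  have := hf (Finset.mem_Ioi.1 hj)
  rw [sub_nonneg]
  exact_mod_cast this.le

lemma vd_pos {d n : ℕ} (f : Fin d → Fin n) (hf : StrictMono f) : 0 < vd f := by
  unfold vd
  rw [Matrix.det_vandermonde]
  refine Finset.prod_pos fun i _ => Finset.prod_pos fun j hj => ?_
  have := hf (Finset.mem_Ioi.1 hj)
  rw [sub_pos]
  exact_mod_cast this

lemma nonneg_all {d n : ℕ} {A : Matrix (Fin d) (Fin n) ℝ} (hA : A.TotallyNonneg)
    (f : Fin d → Fin n) : 0 ≤ dt A f * vd f := by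
  by_cases hf : Function.Injective f
  · set σ := Tuple.sort f
    have hm : StrictMono (f ∘ σ) :=
      (Tuple.monotone_sort f).strictMono_of_injective (hf.comp σ.injective)
    have h1 := hA.2 (f ∘ σ) hm
    have h2 := vd_nonneg (f ∘ σ) hm
    have e1 : (A.submatrix id (f ∘ σ)).det = Equiv.Perm.sign σ * dt A f := by
      unfold dt
      rw [← Matrix.det_permute']; rfl
    have e2 : vd (f ∘ σ) = Equiv.Perm.sign σ * vd f := by
      unfold vd
      rw [← Matrix.det_permute]; rfl
    rw [e1] at h1; rw [e2] at h2
    have := mul_nonneg h1 h2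
    rcases Int.units_eq_one_or (Equiv.Perm.sign σ) with h | h <;> rw [h] at this <;> simpa using this
  · have : dt A f = 0 := by
      simp only [Function.Injective, not_forall] at hf
      obtain ⟨i, j, hij, hne⟩ := hf
      exact Matrix.det_zero_of_column_eq hne (fun k => by simp [hij])
    simp [this]

lemma tn_of_nonneg {d n : ℕ} {A : Matrix (Fin d) (Fin n) ℝ} (hr : A.rank = d)
    (h : ∀ f : Fin d → Fin n, StrictMono f → 0 ≤ dt A f * vd f) : A.TotallyNonneg := by
  refine ⟨hr, fun f hf => ?_⟩
  exact nonneg_of_mul_nonneg_left (h f hf) (vd_pos f hf)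

lemma vd_update {d n : ℕ} (f : Fin d → Fin n) (p : Fin d) :
    ∃ c : ℝ, ∀ x : Fin n, vd (Function.update f p x) =
      c * ∏ q ∈ univ.erase p, (((x : ℕ) : ℝ) - ((f q : ℕ) : ℝ)) := by
  refine ⟨(∏ i ∈ univ.erase p, ∏ j ∈ (Ioi i).erase p, (((f j : ℕ) : ℝ) - ((f i : ℕ) : ℝ))) *
    (-1) ^ (Ioi p).card, fun x => ?_⟩
  unfold vd
  rw [Matrix.det_vandermonde, ← Finset.mul_prod_erase univ _ (Finset.mem_univ p)]
  have h1 : ∏ j ∈ Ioi p, (((Function.update f p x j : ℕ) : ℝ) - ((Function.update f p x p : ℕ) : ℝ))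
      = (-1) ^ (Ioi p).card * ∏ q ∈ Ioi p, (((x : ℕ) : ℝ) - ((f q : ℕ) : ℝ)) := by
    rw [← Finset.prod_const, ← Finset.prod_mul_distrib]
    refine Finset.prod_congr rfl fun j hj => ?_
    have : j ≠ p := (Finset.mem_Ioi.1 hj).ne'
    simp [this]
  have h2 : ∏ i ∈ univ.erase p, ∏ j ∈ Ioi i,
      (((Function.update f p x j : ℕ) : ℝ) - ((Function.update f p x i : ℕ) : ℝ))
      = (∏ i ∈ univ.erase p, ∏ j ∈ (Ioi i).erase p, (((f j : ℕ) : ℝ) - ((f i : ℕ) : ℝ))) *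
        ∏ q ∈ Iio p, (((x : ℕ) : ℝ) - ((f q : ℕ) : ℝ)) := by
    have h3 : ∏ q ∈ Iio p, (((x : ℕ) : ℝ) - ((f q : ℕ) : ℝ)) =
        ∏ q ∈ univ.erase p, if q < p then (((x : ℕ) : ℝ) - ((f q : ℕ) : ℝ)) else 1 := by
      rw [Finset.prod_ite, Finset.prod_const_one, mul_one]
      refine Finset.prod_congr ?_ fun _ _ => rfl
      ext q; simp; exact fun h => h.ne
    rw [h3, ← Finset.prod_mul_distrib]
    refine Finset.prod_congr rfl fun i hi => ?_
    have hip : i ≠ p := Finset.ne_of_mem_erase hi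
    have h4 : ∏ j ∈ (Ioi i).erase p, (((f j : ℕ) : ℝ) - ((f i : ℕ) : ℝ)) =
        ∏ j ∈ (Ioi i).erase p,
      (((Function.update f p x j : ℕ) : ℝ) - ((Function.update f p x i : ℕ) : ℝ)) := by
      refine Finset.prod_congr rfl fun j hj => ?_
      simp [hip, Finset.ne_of_mem_erase hj]
    rw [h4]
    split_ifs with h
    · rw [← Finset.prod_erase_mul (Ioi i) _ (Finset.mem_Ioi.2 h)]
      simp [hip]
    · rw [Finset.erase_eq_of_notMem (by simpa using h), mul_one]
  rw [h1, h2]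
  have h5 : univ.erase p = Iio p ∪ Ioi p := by
    ext q; simp
  have h6 : Disjoint (Iio p) (Ioi p) := by
    rw [Finset.disjoint_left]; intro q hq; simp at hq ⊢; exact hq.le
  nth_rewrite 3 [h5]
  rw [Finset.prod_union h6]
  ring

lemma submatrix_update {d n : ℕ} (A : Matrix (Fin d) (Fin n) ℝ) (f : Fin d → Fin n) (p : Fin d)
    (x : Fin n) : A.submatrix id (Function.update f p x) =
      (A.submatrix id f).updateCol p (cols A x) := by
  ext i j
  by_cases h : j = p
  · subst h; simp [cols]
  · simp [h]

lemma dt_update_sum {d n : ℕ} (A : Matrix (Fin d) (Fin n) ℝ) (f : Fin d → Fin n) (p : Fin d)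
    (x : Fin n) (c : Fin d → ℝ) (h : cols A x = ∑ k, c k • cols A (f k)) :
    dt A (Function.update f p x) = c p * dt A f := by
  unfold dt
  rw [submatrix_update]
  have := Matrix.det_updateCol_sum (A.submatrix id f) p c
  rw [smul_eq_mul] at this
  rw [← this]
  congr 2
  rw [h]
  ext k
  simp [cols]

/-- The core sign contradiction. -/
lemma core {d n : ℕ} {A : Matrix (Fin d) (Fin n) ℝ} (hA : A.TotallyNonneg)
    (e : Fin d → Fin n) (bs : Module.Basis (Fin d) ℝ (Fin d → ℝ)) (hbs : ∀ k, bs k = cols A (e k))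
    (p q : Fin d) (c x : Fin n)
    (h1 : bs.repr (cols A c) p ≠ 0) (h2 : bs.repr (cols A c) q = 0)
    (h3 : bs.repr (cols A x) q ≠ 0)
    (hc : ∀ k, e k ≠ c) (hx : ∀ k, e k ≠ x)
    (hcross : (((e p : ℕ) : ℝ) - (e q : ℕ)) * (((c : ℕ) : ℝ) - (e q : ℕ)) *
      ((((e p : ℕ) : ℝ) - (x : ℕ)) * (((c : ℕ) : ℝ) - (x : ℕ))) < 0) : False := by
  have hpq : p ≠ q := by rintro rfl; simp at hcross
  have he : Function.Injective e := by
    intro i j hij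
    apply bs.injective; rw [hbs, hbs, hij]
  have exc : cols A c = ∑ k, bs.repr (cols A c) k • cols A (e k) := by
    conv_lhs => rw [← bs.sum_repr (cols A c)]
    simp [hbs]
  have exx : cols A x = ∑ k, bs.repr (cols A x) k • cols A (e k) := by
    conv_lhs => rw [← bs.sum_repr (cols A x)]
    simp [hbs]
  set e' := Function.update e q x with he'
  have exc' : cols A c = ∑ k, bs.repr (cols A c) k • cols A (e' k) := by
    conv_lhs => rw [exc]
    refine Finset.sum_congr rfl fun k _ => ?_
    by_cases hk : k = q
    · subst hk; simp [h2]
    · simp [he', hk]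
  have hd0 : dt A e ≠ 0 := by
    unfold dt
    have hli : LinearIndependent ℝ (A.submatrix id e).col := by
      have : (A.submatrix id e).col = bs := by
        funext k; rw [hbs]; rfl
      rw [this]; exact bs.linearIndependent
    have := Matrix.linearIndependent_cols_iff_isUnit.1 hli
    rw [Matrix.isUnit_iff_isUnit_det] at this
    exact this.ne_zero
  have d1 := dt_update_sum A e p c _ exc
  have d2 := dt_update_sum A e q x _ exx
  have d3 := dt_update_sum A e' p c _ exc'
  rw [← he'] at d2
  obtain ⟨v1, hv1⟩ := vd_update e p
  obtain ⟨v2, hv2⟩ := vd_update e' p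
  have n1 := nonneg_all hA e
  have n2 := nonneg_all hA (Function.update e p c)
  have n3 := nonneg_all hA e'
  have n4 := nonneg_all hA (Function.update e' p c)
  have e1 : vd e = v1 * ∏ r ∈ univ.erase p, (((e p : ℕ) : ℝ) - ((e r : ℕ) : ℝ)) := by
    rw [← hv1, Function.update_eq_self]
  have e3 : vd e' = v2 * ∏ r ∈ univ.erase p, (((e p : ℕ) : ℝ) - ((e' r : ℕ) : ℝ)) := by
    rw [← hv2]
    have : e p = e' p := by simp [he', hpq]
    rw [this, Function.update_eq_self]
  have e2 := hv1 c
  have e4 := hv2 c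
  have hcp : e p ≠ c := hc p
  have hinj : ∀ a b : Fin n, a ≠ b → ((a : ℕ) : ℝ) - (b : ℕ) ≠ 0 := by
    intro a b hab h
    rw [sub_eq_zero] at h
    exact hab (Fin.ext (by exact_mod_cast h))
  have hprod : vd e * vd (Function.update e p c) * (vd e' * vd (Function.update e' p c)) < 0 := by
    have he'i : Function.Injective e' := by
      intro i j hij
      by_cases hi : i = q <;> by_cases hj : j = q
      · rw [hi, hj]
      · subst hi; simp [he', hj] at hij; exact absurd hij.symm (hx j)
      · subst hj; simp [he', hi] at hij; exact absurd hij (hx i)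
      · simp [he', hi, hj] at hij; exact he hij
    have hv1n : v1 ≠ 0 := by
      rintro rfl
      rw [zero_mul] at e1
      unfold vd at e1
      rw [Matrix.det_vandermonde_eq_zero_iff] at e1
      obtain ⟨i, j, hij, hne⟩ := e1
      exact hne (he (Fin.ext (by exact_mod_cast hij)))
    have hv2n : v2 ≠ 0 := by
      rintro rfl
      rw [zero_mul] at e3
      unfold vd at e3
      rw [Matrix.det_vandermonde_eq_zero_iff] at e3
      obtain ⟨i, j, hij, hne⟩ := e3
      exact hne (he'i (Fin.ext (by exact_mod_cast hij)))
    have key : ∏ r ∈ univ.erase p, ((((e p : ℕ) : ℝ) - (e r : ℕ)) * (((c : ℕ) : ℝ) - (e r : ℕ)) *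
      ((((e p : ℕ) : ℝ) - (e' r : ℕ)) * (((c : ℕ) : ℝ) - (e' r : ℕ)))) < 0 := by
      rw [← Finset.mul_prod_erase _ _ (Finset.mem_erase.2 ⟨hpq.symm, Finset.mem_univ q⟩)]
      refine mul_neg_of_neg_of_pos (by simpa [he'] using hcross) (Finset.prod_pos fun r hr => ?_)
      have hrq : r ≠ q := Finset.ne_of_mem_erase hr
      have hrp : r ≠ p := Finset.ne_of_mem_erase (Finset.mem_of_mem_erase hr)
      have : e' r = e r := by simp [he', hrq]
      rw [this]
      have i1 := hinj _ _ (fun h => hrp (he h).symm : e p ≠ e r)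
      have i2 := hinj _ _ (hc r).symm
      have i3 := mul_ne_zero i1 i2
      exact mul_self_pos.2 i3
    rw [e1, e2, e3, e4]
    simp only [Finset.prod_mul_distrib] at key
    have h5 : 0 < (v1 * v2) ^ 2 := by positivity
    have := mul_neg_of_pos_of_neg h5 key
    refine lt_of_eq_of_lt ?_ this
    ring
  have m := mul_nonneg (mul_nonneg n1 n2) (mul_nonneg n3 n4)
  rw [d1, d3, d2] at m
  have hpos : 0 < ((dt A e) ^ 2 * bs.repr (cols A c) p * bs.repr (cols A x) q) ^ 2 := by
    positivity
  have := mul_neg_of_pos_of_neg hpos hprod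
  refine absurd m (not_le.2 (lt_of_eq_of_lt ?_ this))
  ring

end Pos

namespace Pos

variable {d n : ℕ}

/-- Rank of a set of columns. -/
noncomputable def rk (v : Fin n → Fin d → ℝ) (X : Set (Fin n)) : ℕ :=
  Module.finrank ℝ (Submodule.span ℝ (v '' X))

lemma rk_mono (v : Fin n → Fin d → ℝ) {X Y : Set (Fin n)} (h : X ⊆ Y) : rk v X ≤ rk v Y :=
  Submodule.finrank_mono (Submodule.span_mono (Set.image_mono h))

lemma rk_submod (v : Fin n → Fin d → ℝ) (X Y : Set (Fin n)) :
    rk v (X ∪ Y) + rk v (X ∩ Y) ≤ rk v X + rk v Y := by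
  unfold rk
  have h := Submodule.finrank_sup_add_finrank_inf_eq (Submodule.span ℝ (v '' X))
    (Submodule.span ℝ (v '' Y))
  rw [Set.image_union, Submodule.span_union, ← h]
  refine Nat.add_le_add_left ?_ _
  apply Submodule.finrank_mono
  refine le_inf ?_ ?_
  · exact Submodule.span_mono (Set.image_mono Set.inter_subset_left)
  · exact Submodule.span_mono (Set.image_mono Set.inter_subset_right)

lemma rk_empty (v : Fin n → Fin d → ℝ) : rk v ∅ = 0 := by
  simp [rk]

lemma rk_union_le (v : Fin n → Fin d → ℝ) (X Y : Set (Fin n)) :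
    rk v (X ∪ Y) ≤ rk v X + rk v Y := by
  have := rk_submod v X Y; omega

lemma rk_univ (v : Fin n → Fin d → ℝ) (hv : Submodule.span ℝ (Set.range v) = ⊤) :
    rk v Set.univ = d := by
  unfold rk; rw [Set.image_univ, hv]; simp

lemma span_of_rank {A : Matrix (Fin d) (Fin n) ℝ} (h : A.rank = d) :
    Submodule.span ℝ (Set.range (cols A)) = ⊤ := by
  apply Submodule.eq_top_of_finrank_eq
  rw [Matrix.rank_eq_finrank_span_cols] at h
  rw [Module.finrank_fin_fun]
  exact h

lemma rank_of_span {A : Matrix (Fin d) (Fin n) ℝ}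
    (h : Submodule.span ℝ (Set.range (cols A)) = ⊤) : A.rank = d := by
  rw [Matrix.rank_eq_finrank_span_cols]
  change Module.finrank ℝ (Submodule.span ℝ (Set.range (cols A))) = d
  rw [h]; simp

/-- A basis of columns adapted to a set `F`. -/
lemma exists_adapted (v : Fin n → Fin d → ℝ) (hv : Submodule.span ℝ (Set.range v) = ⊤)
    (F : Set (Fin n)) : ∃ (e : Fin d → Fin n) (bs : Module.Basis (Fin d) ℝ (Fin d → ℝ)),
      (∀ k, bs k = v (e k)) ∧ ∀ x ∈ F, ∀ k, bs.repr (v x) k ≠ 0 → e k ∈ F := by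
  obtain ⟨b1, hb1F, -, hFb1, hb1⟩ := exists_linearIndepOn_extension
    (linearIndepOn_empty ℝ v) (Set.empty_subset F)
  obtain ⟨b2, -, hb12, hub2, hb2⟩ := exists_linearIndepOn_extension hb1 (Set.subset_univ b1)
  have hspan : ⊤ ≤ Submodule.span ℝ (Set.range (fun i : b2 => v i)) := by
    rw [← hv, Submodule.span_le]
    have : Set.range (fun i : b2 => v i) = v '' b2 := by
      rw [Set.image_eq_range]
    rw [this, ← Set.image_univ]; exact hub2
  have hfin : Fintype b2 := Fintype.ofFinite _
  let bb := Module.Basis.mk hb2 hspan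
  have hbb : ∀ y, bb y = v y := fun y => Module.Basis.mk_apply hb2 hspan y
  have hcard : Fintype.card b2 = d := by
    have := Module.finrank_eq_card_basis bb
    simpa using this.symm
  let eq : b2 ≃ Fin d := Fintype.equivFinOfCardEq hcard
  refine ⟨fun k => (eq.symm k : Fin n), bb.reindex eq, fun k => ?_, fun x hx k hk => ?_⟩
  · simp [hbb]
  · have h1 : v x ∈ Submodule.span ℝ (bb '' {y | (y : Fin n) ∈ b1}) := by
      have : bb '' {y | (y : Fin n) ∈ b1} = v '' b1 := by
        ext z; constructor
        · rintro ⟨y, hy, rfl⟩; exact ⟨y, hy, by simp [hbb]⟩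
        · rintro ⟨y, hy, rfl⟩; exact ⟨⟨y, hb12 hy⟩, hy, by simp [hbb]⟩
      rw [this]; exact hFb1 ⟨x, hx, rfl⟩
    rw [Module.Basis.mem_span_image] at h1
    have h2 : eq.symm k ∈ ((bb.repr (v x)).support : Set b2) := by
      simpa using hk
    exact hb1F (h1 h2)

lemma rk_of_closed (v : Fin n → Fin d → ℝ) (e : Fin d → Fin n)
    (bs : Module.Basis (Fin d) ℝ (Fin d → ℝ)) (hbs : ∀ k, bs k = v (e k)) (X : Set (Fin n))
    (hX : ∀ x ∈ X, ∀ k, bs.repr (v x) k ≠ 0 → e k ∈ X) :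
    rk v X = {k | e k ∈ X}.ncard := by
  have : Submodule.span ℝ (v '' X) = Submodule.span ℝ (bs '' {k | e k ∈ X}) := by
    apply le_antisymm
    · rw [Submodule.span_le]
      rintro _ ⟨x, hx, rfl⟩
      rw [SetLike.mem_coe, Module.Basis.mem_span_image]
      intro k hk
      exact hX x hx k (by simpa using hk)
    · apply Submodule.span_mono
      rintro _ ⟨k, hk, rfl⟩
      exact ⟨e k, hk, (hbs k).symm⟩
  unfold rk
  classical
  rw [this, Set.ncard_eq_toFinset_card', Set.image_eq_range]
  rw [finrank_span_eq_card (b := fun x : {k | e k ∈ X} => bs x)]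
  · simp
  · exact bs.linearIndependent.comp _ Subtype.val_injective

/-- If `F` does not split, then its complement splits along gaps. -/
lemma gap_split {A : Matrix (Fin d) (Fin n) ℝ} (hA : A.TotallyNonneg) (F P : Set (Fin n))
    (hF : ∀ X ⊆ F, X.Nonempty → (F \ X).Nonempty →
      rk (cols A) X + rk (cols A) (F \ X) ≠ rk (cols A) F)
    (hP : Disjoint P F)
    (hsep : ∀ b ∈ P, ∀ x, x ∉ P → x ∉ F →
      (F ∩ Set.Ioo (min b x) (max b x)).Nonempty ∧ (F \ Set.Ioo (min b x) (max b x)).Nonempty) :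
    rk (cols A) (F ∪ P) + rk (cols A) Pᶜ = rk (cols A) F + d := by
  have hsp := span_of_rank hA.1
  obtain ⟨e, bs, hbs, hcl⟩ := exists_adapted (cols A) hsp F
  have he : Function.Injective e := by
    intro i j hij
    apply bs.injective; rw [hbs, hbs, hij]
  have hnot : ∀ y k, bs.repr (cols A y) k ≠ 0 → e k ≠ y → ∀ l, e l ≠ y := by
    rintro y k h1 h2 l rfl
    rw [← hbs l] at h1
    have : k ≠ l := fun h => h2 (by rw [h])
    simp [this] at h1
  -- a swap across the gap is impossible
  have main : ∀ x q, x ∉ F → e q ∉ F → (x ∈ P ↔ e q ∉ P) → bs.repr (cols A x) q = 0 := by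
    intro x q hxF hqF hPQ
    by_contra hne
    have hxq : e q ≠ x := by rintro rfl; tauto
    obtain ⟨⟨a, haF, haI⟩, ⟨c, hcF, hcI⟩⟩ :
        (F ∩ Set.Ioo (min (e q) x) (max (e q) x)).Nonempty ∧
        (F \ Set.Ioo (min (e q) x) (max (e q) x)).Nonempty := by
      by_cases h : x ∈ P
      · rw [min_comm, max_comm]; exact hsep x h (e q) (hPQ.1 h) hqF
      · exact hsep (e q) (by tauto) x h hxF
    set I := Set.Ioo (min (e q) x) (max (e q) x) with hI
    have hsplit := hF (F ∩ I) Set.inter_subset_left ⟨a, haF, haI⟩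
      ⟨c, hcF, fun h => hcI h.2⟩
    have hdiff : F \ (F ∩ I) = F \ I := by ext; simp
    rw [hdiff] at hsplit
    have : ∃ y ∈ F, ∃ p, bs.repr (cols A y) p ≠ 0 ∧ (y ∈ I ↔ e p ∉ I) := by
      by_contra hcon
      push Not at hcon
      apply hsplit
      rw [rk_of_closed _ e bs hbs (F ∩ I), rk_of_closed _ e bs hbs (F \ I),
        rk_of_closed _ e bs hbs F hcl, ← Set.ncard_union_eq]
      · congr 1; ext k; simp only [Set.mem_union, Set.mem_ofPred_eq, Set.mem_inter_iff,
          Set.mem_sdiff]; tauto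
      · rw [Set.disjoint_left]; rintro k hk1 hk2; exact hk2.2 hk1.2
      · intro y hy k hk; have := hcon y hy.1 k hk; have := hcl y hy.1 k hk
        exact ⟨this, fun h => by have := hy.2; tauto⟩
      · intro y hy k hk; have := hcon y hy.1 k hk; have := hcl y hy.1 k hk
        exact ⟨this, by have := hy.2; tauto⟩
    obtain ⟨y, hyF, p, hp, hyI⟩ := this
    have hpF : e p ∈ F := hcl y hyF p hp
    have hyq : bs.repr (cols A y) q = 0 := by
      by_contra h; exact hqF (hcl y hyF q h)
    refine core hA e bs hbs p q y x hp hyq hne (hnot y p hp ?_) (hnot x q hne hxq) ?_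
    · rintro rfl; tauto
    · have r : ∀ z ∈ F, z ≠ e q ∧ z ≠ x := fun z hz =>
        ⟨fun h => hqF (h ▸ hz), fun h => hxF (h ▸ hz)⟩
      have key : ∀ z ∈ F, (z ∈ I → (((z : ℕ) : ℝ) - (e q : ℕ)) * (((z : ℕ) : ℝ) - (x : ℕ)) < 0) ∧
          (z ∉ I → 0 < (((z : ℕ) : ℝ) - (e q : ℕ)) * (((z : ℕ) : ℝ) - (x : ℕ))) := by
        intro z hz
        obtain ⟨r1, r2⟩ := r z hz
        have c1 : ∀ u w : Fin n, u < w → ((u : ℕ) : ℝ) < ((w : ℕ) : ℝ) := by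
          intro u w h; exact_mod_cast h
        constructor
        · intro hzI
          rw [hI, Set.mem_Ioo, min_lt_iff, lt_max_iff] at hzI
          rcases lt_or_gt_of_ne r1 with h1 | h1 <;> rcases lt_or_gt_of_ne r2 with h2 | h2
          · exact absurd hzI.1 (by rintro (h | h) <;> order)
          · exact mul_neg_of_neg_of_pos (sub_neg.2 (c1 _ _ h1)) (sub_pos.2 (c1 _ _ h2))
          · exact mul_neg_of_pos_of_neg (sub_pos.2 (c1 _ _ h1)) (sub_neg.2 (c1 _ _ h2))
          · exact absurd hzI.2 (by rintro (h | h) <;> order)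
        · intro hzI
          rw [hI, Set.mem_Ioo, min_lt_iff, lt_max_iff] at hzI
          rcases lt_or_gt_of_ne r1 with h1 | h1 <;> rcases lt_or_gt_of_ne r2 with h2 | h2
          · exact mul_pos_of_neg_of_neg (sub_neg.2 (c1 _ _ h1)) (sub_neg.2 (c1 _ _ h2))
          · exact absurd ⟨Or.inr h2, Or.inl h1⟩ hzI
          · exact absurd ⟨Or.inl h1, Or.inr h2⟩ hzI
          · exact mul_pos (sub_pos.2 (c1 _ _ h1)) (sub_pos.2 (c1 _ _ h2))
      have k1 := key y hyF
      have k2 := key (e p) hpF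
      have : (((e p : ℕ) : ℝ) - (e q : ℕ)) * (((e p : ℕ) : ℝ) - (x : ℕ)) *
        ((((y : ℕ) : ℝ) - (e q : ℕ)) * (((y : ℕ) : ℝ) - (x : ℕ))) < 0 := by
        by_cases h : y ∈ I
        · exact mul_neg_of_pos_of_neg (k2.2 (hyI.1 h)) (k1.1 h)
        · exact mul_neg_of_neg_of_pos (k2.1 (by tauto)) (k1.2 h)
      refine lt_of_eq_of_lt ?_ this
      ring
  rw [Set.disjoint_left] at hP
  rw [rk_of_closed _ e bs hbs (F ∪ P), rk_of_closed _ e bs hbs Pᶜ,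
    rk_of_closed _ e bs hbs F hcl]
  · have h1 := Set.ncard_union_add_ncard_inter {k | e k ∈ F ∪ P} {k | e k ∈ Pᶜ}
    have h2 : {k | e k ∈ F ∪ P} ∪ {k | e k ∈ Pᶜ} = Set.univ := by
      ext k; simp only [Set.mem_union, Set.mem_ofPred_eq, Set.mem_compl_iff, Set.mem_univ]; tauto
    have h3 : {k | e k ∈ F ∪ P} ∩ {k | e k ∈ Pᶜ} = {k | e k ∈ F} := by
      ext k; have := @hP (e k)
      simp only [Set.mem_union, Set.mem_ofPred_eq, Set.mem_compl_iff, Set.mem_inter_iff]; tauto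
    rw [h2, h3, Set.ncard_univ, Nat.card_eq_fintype_card, Fintype.card_fin] at h1
    omega
  · intro y hy k hk
    by_contra h
    rw [Set.mem_compl_iff, not_not] at h
    rw [Set.mem_compl_iff] at hy
    by_cases hyF : y ∈ F
    · exact hP h (hcl y hyF k hk)
    · exact hk (main y k hyF (hP h) (by tauto))
  · intro y hy k hk
    by_contra h
    rw [Set.mem_union, not_or] at h
    by_cases hyF : y ∈ F
    · exact h.1 (hcl y hyF k hk)
    · exact hk (main y k hyF h.1 (by have := hy.resolve_left hyF; tauto))

end Pos

namespace Pos

variable {d n : ℕ}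

/-- Reduction of a natural number to a cyclic index. -/
def ix (n : ℕ) [NeZero n] (k : ℕ) : Fin n := Fin.ofNat n k

lemma ix_val [NeZero n] (k : ℕ) : (ix n k : ℕ) = k % n := rfl

lemma ix_eq_iff [NeZero n] (a b : ℕ) : ix n a = ix n b ↔ a % n = b % n := by
  rw [Fin.ext_iff, ix_val, ix_val]

lemma ix_fin [NeZero n] (x : Fin n) : ix n (x : ℕ) = x := by
  apply Fin.ext; rw [ix_val, Nat.mod_eq_of_lt x.2]

lemma ix_add [NeZero n] (a q : ℕ) : ix n (a + q * n) = ix n a := by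
  rw [ix_eq_iff]; simp

lemma ix_add_one [NeZero n] (a : ℕ) : ix n (a + n) = ix n a := by
  rw [ix_eq_iff]; simp

lemma ix_inj [NeZero n] {a b : ℕ} (h : ix n a = ix n b) (h1 : a ≤ b) (h2 : b < a + n) : a = b := by
  rw [ix_eq_iff] at h
  have := (Nat.modEq_iff_dvd' h1).1 h
  have := Nat.eq_zero_of_dvd_of_lt this (by omega)
  omega

lemma ix_eq_shift [NeZero n] {a b : ℕ} (h : ix n a = ix n b) (h1 : a ≤ b) :
    ∃ q, b = a + q * n := by
  rw [ix_eq_iff] at h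
  obtain ⟨q, hq⟩ := (Nat.modEq_iff_dvd' h1).1 h
  exact ⟨q, by rw [mul_comm q n, ← hq]; omega⟩

/-- Every cyclic index has a lift in each window of length `n`. -/
lemma ix_lift [NeZero n] (x : Fin n) (i : ℕ) : ∃ k, i < k ∧ k ≤ i + n ∧ ix n k = x := by
  have hn : 0 < n := Nat.pos_of_ne_zero (NeZero.ne n)
  have hx := x.2
  have h1 := Nat.div_add_mod i n
  have h2 := Nat.mod_lt i hn
  by_cases h : i % n < x
  · refine ⟨x + (i / n) * n, ?_, ?_, by rw [ix_add, ix_fin]⟩ <;> rw [mul_comm] <;> omega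
  · refine ⟨x + (i / n + 1) * n, ?_, ?_, by rw [ix_add, ix_fin]⟩ <;> rw [add_mul, mul_comm] <;> omega

/-- Cyclic intervals. -/
def arc (n : ℕ) [NeZero n] (i j : ℕ) : Set (Fin n) := {x | ∃ k, i < k ∧ k ≤ j ∧ ix n k = x}

lemma mem_arc [NeZero n] {i j : ℕ} {x : Fin n} :
    x ∈ arc n i j ↔ ∃ k, i < k ∧ k ≤ j ∧ ix n k = x := Iff.rfl

lemma arc_full [NeZero n] (i : ℕ) : arc n i (i + n) = Set.univ := by
  ext x; simp only [Set.mem_univ, iff_true]; exact ix_lift x i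

lemma arc_shift [NeZero n] (i j q : ℕ) : arc n (i + q * n) (j + q * n) = arc n i j := by
  ext x; constructor
  · rintro ⟨k, h1, h2, rfl⟩
    refine ⟨k - q * n, by omega, by omega, ?_⟩
    rw [← ix_add (k - q * n) q]; congr 1; omega
  · rintro ⟨k, h1, h2, rfl⟩
    exact ⟨k + q * n, by omega, by omega, ix_add k q⟩

lemma arc_compl [NeZero n] {i j : ℕ} (h1 : i ≤ j) (h2 : j ≤ i + n) :
    (arc n i j)ᶜ = arc n j (i + n) := by
  ext x
  rw [Set.mem_compl_iff]
  constructor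
  · intro h
    obtain ⟨k, hk1, hk2, rfl⟩ := ix_lift x i
    refine ⟨k, ?_, hk2, rfl⟩
    by_contra hc
    exact h ⟨k, hk1, by omega, rfl⟩
  · rintro ⟨k, hk1, hk2, rfl⟩ ⟨l, hl1, hl2, hl3⟩
    have := ix_inj hl3 (by omega) (by omega)
    omega

lemma mod_cases (l k : ℕ) (hn : 0 < n) (h1 : l ≤ k) (h2 : k < l + n) :
    (k % n = k - n * (l / n) ∧ k < n * (l / n) + n) ∨
      (k % n = k - n * (l / n) - n ∧ n * (l / n) + n ≤ k) := by
  have e1 := Nat.div_add_mod l n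
  have e2 := Nat.mod_lt l hn
  by_cases h : k < n * (l / n) + n
  · left; refine ⟨?_, h⟩
    have : k = (k - n * (l / n)) + n * (l / n) := by omega
    conv_lhs => rw [this]
    rw [Nat.add_mul_mod_self_left]
    exact Nat.mod_eq_of_lt (by omega)
  · right; refine ⟨?_, by omega⟩
    have : k = (k - n * (l / n) - n) + n * (l / n + 1) := by rw [mul_add]; omega
    conv_lhs => rw [this]
    rw [Nat.add_mul_mod_self_left]
    exact Nat.mod_eq_of_lt (by omega)

/-- `arc l m` is a maximal arc disjoint from `F`. -/
structure IsGap [NeZero n] (F : Set (Fin n)) (l m : ℕ) : Prop where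
  lt : l < m
  lt' : m < l + n
  disj : Disjoint (arc n l m) F
  left : ix n l ∈ F
  right : ix n (m + 1) ∈ F

lemma exists_gap [NeZero n] (F : Set (Fin n)) (hF : F.Nonempty) (b : Fin n) (hb : b ∉ F) :
    ∃ l m, IsGap F l m ∧ b ∈ arc n l m := by
  classical
  obtain ⟨y, hy⟩ := hF
  have hb0 : ix n (b + n) = b := by rw [ix_add_one, ix_fin]
  have hP : ix n (y : ℕ) ∈ F := by rw [ix_fin]; exact hy
  have hyb : (y : ℕ) ≤ b + n := by have := y.2; omega
  set l := Nat.findGreatest (fun k => ix n k ∈ F) (b + n) with hl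
  have hlF : ix n l ∈ F := Nat.findGreatest_spec (P := fun k => ix n k ∈ F) hyb hP
  have hlb : l ≤ b + n := Nat.findGreatest_le _
  have hlne : l ≠ b + n := by intro h; rw [h, hb0] at hlF; exact hb hlF
  have hgr : ∀ k, l < k → k ≤ b + n → ix n k ∉ F := fun k h1 h2 =>
    Nat.findGreatest_is_greatest (P := fun k => ix n k ∈ F) h1 h2
  have hex : ∃ k, b + n < k ∧ ix n k ∈ F := by
    obtain ⟨k, h1, -, h3⟩ := ix_lift (ix n l) (b + n)
    exact ⟨k, h1, by rw [h3]; exact hlF⟩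
  have hs := Nat.find_spec hex
  have hm : ∀ k, b + n < k → k < Nat.find hex → ix n k ∉ F := fun k h1 h2 h3 =>
    Nat.find_min hex h2 ⟨h1, h3⟩
  have hbl : (b : ℕ) < l := by
    by_contra hc
    obtain ⟨k, h1, h2, h3⟩ := ix_lift y b
    have h4 : k ≤ l := Nat.le_findGreatest h2 (by rw [h3]; exact hy)
    omega
  have hle : Nat.find hex ≤ l + n :=
    Nat.find_min' hex ⟨by omega, by rw [ix_add_one]; exact hlF⟩
  refine ⟨l, Nat.find hex - 1, ⟨by omega, by omega, ?_, hlF, ?_⟩, ⟨b + n, by omega, by omega, hb0⟩⟩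
  · rw [Set.disjoint_left]
    rintro _ ⟨k, h1, h2, rfl⟩
    by_cases h : k ≤ b + n
    · exact hgr k h1 h
    · exact hm k (by omega) (by omega)
  · have : Nat.find hex - 1 + 1 = Nat.find hex := by omega
    rw [this]; exact hs.2

lemma IsGap.sep [NeZero n] {F : Set (Fin n)} {l m : ℕ} (h : IsGap F l m) (b : Fin n)
    (hb : b ∈ arc n l m) (x : Fin n) (hx : x ∉ arc n l m) (hxF : x ∉ F) :
    (F ∩ Set.Ioo (min b x) (max b x)).Nonempty ∧ (F \ Set.Ioo (min b x) (max b x)).Nonempty := by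
  have hn : 0 < n := Nat.pos_of_ne_zero (NeZero.ne n)
  have hlt := h.lt
  have hlt' := h.lt'
  have hx' : x ∈ (arc n l m)ᶜ := hx
  rw [arc_compl hlt.le hlt'.le] at hx'
  obtain ⟨kb, hb1, hb2, rfl⟩ := hb
  obtain ⟨kx, hx1, hx2, rfl⟩ := hx'
  have hx3 : kx ≠ m + 1 := by rintro rfl; exact hxF h.right
  have hx4 : kx ≠ l + n := by rintro rfl; rw [ix_add_one] at hxF; exact hxF h.left
  have c0 := mod_cases l l hn le_rfl (by omega)
  have c1 := mod_cases l kb hn (by omega) (by omega)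
  have c2 := mod_cases l (m + 1) hn (by omega) (by omega)
  have c3 := mod_cases l kx hn (by omega) (by omega)
  have e0 := Nat.div_add_mod l n
  have key : (ix n (m + 1) ∈ Set.Ioo (min (ix n kb) (ix n kx)) (max (ix n kb) (ix n kx)) ∧
      ix n l ∉ Set.Ioo (min (ix n kb) (ix n kx)) (max (ix n kb) (ix n kx))) ∨
      (ix n l ∈ Set.Ioo (min (ix n kb) (ix n kx)) (max (ix n kb) (ix n kx)) ∧
      ix n (m + 1) ∉ Set.Ioo (min (ix n kb) (ix n kx)) (max (ix n kb) (ix n kx))) := by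
    simp only [Set.mem_Ioo, min_lt_iff, lt_max_iff, Fin.lt_def, ix_val]
    generalize n * (l / n) = z at *
    omega
  rcases key with ⟨k1, k2⟩ | ⟨k1, k2⟩
  · exact ⟨⟨_, h.right, k1⟩, ⟨_, h.left, k2⟩⟩
  · exact ⟨⟨_, h.left, k1⟩, ⟨_, h.right, k2⟩⟩

lemma IsGap.eq_aux [NeZero n] {F : Set (Fin n)} {l m l' m' k q : ℕ} (h : IsGap F l m)
    (h' : IsGap F l' m') (h1 : l < k) (h2 : k ≤ m) (h3 : l' < k + q * n) (h4 : k + q * n ≤ m') :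
    arc n l m = arc n l' m' := by
  have hd := Set.disjoint_left.1 h.disj
  have hd' := Set.disjoint_left.1 h'.disj
  have e1 : l + q * n = l' := by
    apply le_antisymm
    · by_contra hc
      exact hd' ⟨l + q * n, by omega, by omega, ix_add l q⟩ h.left
    · by_contra hc
      refine hd ⟨l' - q * n, by omega, by omega, ?_⟩ h'.left
      rw [← ix_add _ q]; congr 1; omega
  have e2 : m + q * n = m' := by
    apply le_antisymm
    · by_contra hc
      refine hd ⟨m' + 1 - q * n, by omega, by omega, ?_⟩ h'.right
      rw [← ix_add _ q]; congr 1; omega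
    · by_contra hc
      refine hd' ⟨m + 1 + q * n, by omega, by omega, ix_add _ q⟩ h.right
  rw [← e1, ← e2, arc_shift]

lemma IsGap.eq_of_mem [NeZero n] {F : Set (Fin n)} {l m l' m' : ℕ} (h : IsGap F l m)
    (h' : IsGap F l' m') {x : Fin n} (hx : x ∈ arc n l m) (hx' : x ∈ arc n l' m') :
    arc n l m = arc n l' m' := by
  obtain ⟨k, h1, h2, rfl⟩ := hx
  obtain ⟨k', h3, h4, h5⟩ := hx'
  rcases le_total k k' with hk | hk
  · obtain ⟨q, rfl⟩ := ix_eq_shift h5.symm hk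
    exact h.eq_aux h' h1 h2 h3 h4
  · obtain ⟨q, rfl⟩ := ix_eq_shift h5 hk
    exact (h'.eq_aux h h3 h4 h1 h2).symm

lemma IsGap.split [NeZero n] {A : Matrix (Fin d) (Fin n) ℝ} (hA : A.TotallyNonneg)
    {F : Set (Fin n)}
    (hF : ∀ X ⊆ F, X.Nonempty → (F \ X).Nonempty →
      rk (cols A) X + rk (cols A) (F \ X) ≠ rk (cols A) F) {l m : ℕ} (h : IsGap F l m) :
    rk (cols A) (F ∪ arc n l m) + rk (cols A) (arc n l m)ᶜ = rk (cols A) F + d :=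
  gap_split hA F _ hF h.disj (fun b hb x hx hxF => h.sep b hb x hx hxF)

lemma rk_le_ncard (v : Fin n → Fin d → ℝ) (X : Set (Fin n)) : rk v X ≤ X.ncard := by
  classical
  unfold rk
  refine le_trans (finrank_span_le_card (v '' X)) ?_
  rw [← Set.ncard_eq_toFinset_card']
  exact Set.ncard_image_le

lemma indep_iff (v : Fin n → Fin d → ℝ) (B : Finset (Fin n)) :
    LinearIndependent ℝ (fun j : B => v j.1) ↔ rk v (B : Set (Fin n)) = B.card := by
  rw [linearIndependent_iff_card_eq_finrank_span]
  have : Set.range (fun j : B => v j.1) = v '' (B : Set (Fin n)) := by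
    rw [Set.image_eq_range]; rfl
  rw [Set.finrank, this, Fintype.card_coe]
  exact eq_comm

lemma basis_of_arcs [NeZero n] {A : Matrix (Fin d) (Fin n) ℝ} (hA : A.TotallyNonneg)
    (B : Set (Fin n)) (hB : B.ncard = d)
    (h : ∀ i j, i ≤ j → j ≤ i + n → (B ∩ arc n i j).ncard ≤ rk (cols A) (arc n i j)) :
    rk (cols A) B = d := by
  by_contra hne
  set r := rk (cols A) with hr
  have hmod : ∀ X Y : Set (Fin n), (B ∩ (X ∪ Y)).ncard + (B ∩ (X ∩ Y)).ncard =
      (B ∩ X).ncard + (B ∩ Y).ncard := by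
    intro X Y
    rw [← Set.ncard_union_add_ncard_inter (B ∩ X) (B ∩ Y), ← Set.inter_union_distrib_left]
    congr 2
    ext; simp; tauto
  have hBlt : r B < (B ∩ B).ncard := by
    have h0 : r B ≤ B.ncard := rk_le_ncard (cols A) B
    rw [Set.inter_self]
    exact lt_of_le_of_ne h0 (by rw [hB]; exact hne)
  obtain ⟨F, hFneg, hFmin⟩ := WellFounded.has_min (measure (Set.ncard (α := Fin n))).wf
    {X | r X < (B ∩ X).ncard} ⟨B, hBlt⟩
  have hFneg : r F < (B ∩ F).ncard := hFneg
  have hFmin : ∀ X, X.ncard < F.ncard → (B ∩ X).ncard ≤ r X := by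
    intro X hX
    by_contra hc
    exact hFmin X (not_le.1 hc) hX
  have hFne : F.Nonempty := by
    rw [Set.nonempty_iff_ne_empty]; rintro rfl; simp at hFneg
  have hconn : ∀ X ⊆ F, X.Nonempty → (F \ X).Nonempty → r X + r (F \ X) ≠ r F := by
    intro X hX hXn hXn' heq
    have h1 := hmod X (F \ X)
    rw [Set.union_sdiff_cancel hX, Set.inter_sdiff_self, Set.inter_empty, Set.ncard_empty] at h1
    have h2 := Set.ncard_sdiff_add_ncard_of_subset hX
    have h3 := (Set.ncard_pos).2 hXn
    have h4 := (Set.ncard_pos).2 hXn'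
    have h5 := hFmin X (by omega)
    have h6 := hFmin (F \ X) (by omega)
    omega
  -- every gap lowers the defect
  have hgap : ∀ l m, IsGap F l m → r (F ∪ arc n l m) + (B ∩ F).ncard ≤
      r F + (B ∩ (F ∪ arc n l m)).ncard := by
    intro l m hg
    have h1 := hg.split hA hconn
    have h2 := h m (l + n) hg.lt'.le (by have := hg.lt; omega)
    rw [← arc_compl hg.lt.le hg.lt'.le] at h2
    have h3 := hmod (F ∪ arc n l m) (arc n l m)ᶜ
    have hd := Set.disjoint_left.1 hg.disj
    have e1 : F ∪ arc n l m ∪ (arc n l m)ᶜ = Set.univ := by ext x; simp; tauto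
    have e2 : (F ∪ arc n l m) ∩ (arc n l m)ᶜ = F := by
      ext x; have := @hd x; simp; tauto
    rw [e1, e2, Set.inter_univ, hB] at h3
    change r (F ∪ arc n l m) + r (arc n l m)ᶜ = r F + d at h1
    change _ ≤ r _ at h2
    omega
  obtain ⟨U, hU, hUmax⟩ := WellFounded.has_min
    (measure (fun X : Set (Fin n) => Xᶜ.ncard)).wf
    {X | F ⊆ X ∧ r X + (B ∩ F).ncard ≤ r F + (B ∩ X).ncard ∧
      ∀ l m, IsGap F l m → ∀ x ∈ arc n l m, x ∈ X → arc n l m ⊆ X}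
    ⟨F, subset_rfl, le_rfl, fun l m hg x hx hxF => absurd hxF (Set.disjoint_left.1 hg.disj hx)⟩
  obtain ⟨hFU, hUle, hUcl⟩ := hU
  by_cases hUu : U = Set.univ
  · subst hUu
    rw [Set.inter_univ, hB] at hUle
    have : r Set.univ = d := rk_univ _ (span_of_rank hA.1)
    omega
  · obtain ⟨b, hb⟩ := (Set.ne_univ_iff_exists_notMem U).1 hUu
    obtain ⟨l, m, hg, hbm⟩ := exists_gap F hFne b (fun hbF => hb (hFU hbF))
    have hdU : ∀ x ∈ arc n l m, x ∉ U := fun x hx hxU => hb (hUcl l m hg x hx hxU hbm)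
    refine hUmax (U ∪ arc n l m) ⟨hFU.trans Set.subset_union_left, ?_, ?_⟩ ?_
    · have h1 := hgap l m hg
      have h2 := rk_submod (cols A) U (F ∪ arc n l m)
      have h3 := hmod U (F ∪ arc n l m)
      have e1 : U ∪ (F ∪ arc n l m) = U ∪ arc n l m := by
        ext x; have := @hFU x; simp; tauto
      have e2 : U ∩ (F ∪ arc n l m) = F := by
        ext x; have := @hFU x; have := hdU x; simp; tauto
      rw [e1, e2] at h2 h3
      change r _ + r _ ≤ r _ + r _ at h2
      omega
    · intro l' m' hg' x hx hxU
      rcases hxU with hxU | hxU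
      · exact (hUcl l' m' hg' x hx hxU).trans Set.subset_union_left
      · rw [hg'.eq_of_mem hg hx hxU]; exact Set.subset_union_right
    · refine Set.ncard_lt_ncard ?_ (Set.toFinite _)
      refine ⟨Set.compl_subset_compl.2 Set.subset_union_left, fun hs => ?_⟩
      exact hs hb (Or.inr hbm)

lemma exists_arc_sep [NeZero n] {A : Matrix (Fin d) (Fin n) ℝ} (hA : A.TotallyNonneg)
    (F₀ : Set (Fin n)) (h1 : F₀.Nonempty) (h2 : F₀ᶜ.Nonempty)
    (h3 : rk (cols A) F₀ + rk (cols A) F₀ᶜ = d) :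
    ∃ l m, l < m ∧ m < l + n ∧ rk (cols A) (arc n l m) + rk (cols A) (arc n m (l + n)) = d := by
  have hu : rk (cols A) Set.univ = d := rk_univ _ (span_of_rank hA.1)
  set r := rk (cols A)
  have hsub : ∀ X Y, r (X ∪ Y) + r (X ∩ Y) ≤ r X + r Y := rk_submod (cols A)
  obtain ⟨F, ⟨hF1, hF2, hF3⟩, hFmin⟩ := WellFounded.has_min (measure (Set.ncard (α := Fin n))).wf
    {X | X.Nonempty ∧ Xᶜ.Nonempty ∧ r X + r Xᶜ = d} ⟨F₀, h1, h2, h3⟩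
  have hge : ∀ X, d ≤ r X + r Xᶜ := by
    intro X; have := hsub X Xᶜ; rw [Set.union_compl_self, hu] at this; omega
  have hconn : ∀ X ⊆ F, X.Nonempty → (F \ X).Nonempty → r X + r (F \ X) ≠ r F := by
    intro X hX hXn hXn' heq
    refine hFmin X ⟨hXn, hXn'.mono (fun x hx => hx.2), ?_⟩ ?_
    · have h4 := hsub (F \ X) Fᶜ
      have e1 : F \ X ∪ Fᶜ = Xᶜ := by ext x; have := @hX x; simp; tauto
      rw [e1] at h4
      have := hge X
      omega
    · refine Set.ncard_lt_ncard ?_ (Set.toFinite _)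
      refine ⟨hX, fun hs => ?_⟩
      obtain ⟨x, hx1, hx2⟩ := hXn'
      exact hx2 (hs hx1)
  obtain ⟨b, hb⟩ := hF2
  obtain ⟨l, m, hg, hbm⟩ := exists_gap F hF1 b hb
  refine ⟨l, m, hg.lt, hg.lt', ?_⟩
  change r _ + r _ = d
  rw [← arc_compl hg.lt.le hg.lt'.le]
  have h4 : r (F ∪ arc n l m) + r (arc n l m)ᶜ = r F + d := hg.split hA hconn
  have h5 := hsub (F ∪ arc n l m) Fᶜ
  have hd := Set.disjoint_left.1 hg.disj
  have e1 : F ∪ arc n l m ∪ Fᶜ = Set.univ := by ext x; simp; tauto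
  have e2 : (F ∪ arc n l m) ∩ Fᶜ = arc n l m := by ext x; have := @hd x; simp; tauto
  rw [e1, e2, hu] at h5
  have := hge (arc n l m)
  omega

end Pos

namespace Pos

variable {d n : ℕ}

lemma rk_insert_mem (v : Fin n → Fin d → ℝ) {X : Set (Fin n)} {c : Fin n}
    (h : v c ∈ Submodule.span ℝ (v '' X)) : rk v (insert c X) = rk v X := by
  unfold rk
  rw [Set.image_insert_eq, Submodule.span_insert_eq_span h]

lemma rk_insert_notMem (v : Fin n → Fin d → ℝ) {X : Set (Fin n)} {c : Fin n}
    (h : v c ∉ Submodule.span ℝ (v '' X)) : rk v (insert c X) = rk v X + 1 := by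
  unfold rk
  rw [Set.image_insert_eq, Submodule.span_insert, sup_comm]
  exact Submodule.finrank_sup_span_singleton h

/-- Independence of a finite set of columns. -/
def ind (v : Fin n → Fin d → ℝ) (B : Finset (Fin n)) : Prop := rk v (B : Set (Fin n)) = B.card

lemma rk_le_card (v : Fin n → Fin d → ℝ) (B : Finset (Fin n)) : rk v (B : Set (Fin n)) ≤ B.card := by
  have := rk_le_ncard v (B : Set (Fin n))
  rwa [Set.ncard_coe_finset] at this

lemma ind.subset {v : Fin n → Fin d → ℝ} {B I : Finset (Fin n)} (h : ind v B) (hI : I ⊆ B) :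
    ind v I := by
  have h1 := rk_union_le v (I : Set (Fin n)) ((B \ I : Finset (Fin n)) : Set (Fin n))
  rw [← Finset.coe_union, Finset.union_sdiff_of_subset hI, h] at h1
  have h2 := rk_le_card v (B \ I)
  have h3 := rk_le_card v I
  have h4 := Finset.card_sdiff_add_card_eq_card hI
  unfold ind; omega

lemma ind_empty (v : Fin n → Fin d → ℝ) : ind v ∅ := by
  unfold ind; simp [rk_empty]

lemma ind_insert {v : Fin n → Fin d → ℝ} {I : Finset (Fin n)} (h : ind v I) {c : Fin n}
    (hc : v c ∉ Submodule.span ℝ (v '' (I : Set (Fin n)))) : ind v (insert c I) := by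
  have hcI : c ∉ I := fun hI => hc (Submodule.subset_span ⟨c, hI, rfl⟩)
  unfold ind
  rw [Finset.coe_insert, rk_insert_notMem v hc, h, Finset.card_insert_of_notMem hcI]

lemma not_ind_insert {v : Fin n → Fin d → ℝ} {I : Finset (Fin n)} {c : Fin n} (hcI : c ∉ I)
    (hc : v c ∈ Submodule.span ℝ (v '' (I : Set (Fin n)))) : ¬ ind v (insert c I) := by
  unfold ind
  rw [Finset.coe_insert, rk_insert_mem v hc, Finset.card_insert_of_notMem hcI]
  have := rk_le_card v I
  omega

lemma exists_ind_ext (v : Fin n → Fin d → ℝ) {I F : Finset (Fin n)} (h : ind v I) (hI : I ⊆ F) :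
    ∃ B, I ⊆ B ∧ B ⊆ F ∧ ind v B ∧
      Submodule.span ℝ (v '' (B : Set (Fin n))) = Submodule.span ℝ (v '' (F : Set (Fin n))) := by
  classical
  obtain ⟨B, hB, hmax⟩ := Finset.exists_max_image
    (F.powerset.filter (fun B => I ⊆ B ∧ ind v B)) Finset.card ⟨I, by simp [h, hI]⟩
  simp only [Finset.mem_filter, Finset.mem_powerset] at hB hmax
  refine ⟨B, hB.2.1, hB.1, hB.2.2, le_antisymm (Submodule.span_mono (Set.image_mono hB.1)) ?_⟩
  rw [Submodule.span_le]
  rintro _ ⟨c, hc, rfl⟩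
  by_contra hcon
  have hcB : c ∉ B := fun hI => hcon (Submodule.subset_span ⟨c, hI, rfl⟩)
  have := hmax (insert c B) ⟨Finset.insert_subset hc hB.1,
    hB.2.1.trans (Finset.subset_insert _ _), ind_insert hB.2.2 hcon⟩
  rw [Finset.card_insert_of_notMem hcB] at this
  omega

lemma exists_ind_base (v : Fin n → Fin d → ℝ) (F : Finset (Fin n)) :
    ∃ B ⊆ F, ind v B ∧ B.card = rk v (F : Set (Fin n)) := by
  obtain ⟨B, -, h1, h2, h3⟩ := exists_ind_ext v (ind_empty v) (Finset.empty_subset F)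
  refine ⟨B, h1, h2, ?_⟩
  rw [← h2]; unfold rk; rw [h3]

lemma exists_basis_ext (v : Fin n → Fin d → ℝ) (hv : rk v Set.univ = d) {I : Finset (Fin n)}
    (h : ind v I) : ∃ B, I ⊆ B ∧ ind v B ∧ B.card = d := by
  obtain ⟨B, h0, h1, h2, h3⟩ := exists_ind_ext v h (Finset.subset_univ I)
  refine ⟨B, h0, h2, ?_⟩
  rw [← h2]; refine Eq.trans ?_ hv; unfold rk; rw [h3, Finset.coe_univ]

lemma span_iff_ind (v : Fin n → Fin d → ℝ) {X : Finset (Fin n)} {c : Fin n} (hc : c ∉ X) :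
    v c ∈ Submodule.span ℝ (v '' (X : Set (Fin n))) ↔ ∃ I ⊆ X, ind v I ∧ ¬ ind v (insert c I) := by
  constructor
  · intro h
    obtain ⟨B, -, h1, h2, h3⟩ := exists_ind_ext v (ind_empty v) (Finset.empty_subset X)
    exact ⟨B, h1, h2, not_ind_insert (fun h => hc (h1 h)) (by rw [h3]; exact h)⟩
  · rintro ⟨I, h1, h2, h3⟩
    by_contra hcon
    exact h3 (ind_insert h2 fun h => hcon (Submodule.span_mono (Set.image_mono h1) h))

lemma reps_iff {A : Matrix (Fin d) (Fin n) ℝ} {P : Finset (Fin n) → Prop}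
    (h : A.RepresentsBases P) (B : Finset (Fin n)) : P B ↔ B.card = d ∧ ind (cols A) B := by
  rw [h B]
  have := indep_iff (cols A) B
  unfold ind
  rw [← this]
  rfl

lemma ind_iff_of_reps {A : Matrix (Fin d) (Fin n) ℝ} (hA : A.rank = d)
    {P : Finset (Fin n) → Prop} (h : A.RepresentsBases P) (I : Finset (Fin n)) :
    ind (cols A) I ↔ ∃ B, I ⊆ B ∧ P B := by
  constructor
  · intro hI
    obtain ⟨B, h1, h2, h3⟩ := exists_basis_ext (cols A) (rk_univ _ (span_of_rank hA)) hI
    exact ⟨B, h1, (reps_iff h B).2 ⟨h3, h2⟩⟩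
  · rintro ⟨B, h1, h2⟩
    exact ((reps_iff h B).1 h2).2.subset h1

/-- The affine permutation attached to a vector configuration. -/
def Spec [NeZero n] (v : Fin n → Fin d → ℝ) (g : ℕ → ℕ) : Prop :=
  (∀ k, k ≤ g k) ∧ ∀ k m, k ≤ m →
    (v (ix n k) ∈ Submodule.span ℝ (v '' arc n k m) ↔ g k ≤ m)

lemma span_iff_of_reps {d' : ℕ} {A : Matrix (Fin d) (Fin n) ℝ} {A' : Matrix (Fin d') (Fin n) ℝ}
    (hA : A.rank = d) (hA' : A'.rank = d') {P : Finset (Fin n) → Prop} (h : A.RepresentsBases P)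
    (h' : A'.RepresentsBases P) (X : Set (Fin n)) (c : Fin n) :
    cols A c ∈ Submodule.span ℝ (cols A '' X) ↔ cols A' c ∈ Submodule.span ℝ (cols A' '' X) := by
  classical
  by_cases hc : c ∈ X
  · exact iff_of_true (Submodule.subset_span ⟨c, hc, rfl⟩) (Submodule.subset_span ⟨c, hc, rfl⟩)
  · obtain ⟨Y, rfl⟩ : ∃ Y : Finset (Fin n), X = Y := ⟨X.toFinset, by simp⟩
    rw [span_iff_ind _ (by exact_mod_cast hc), span_iff_ind _ (by exact_mod_cast hc)]
    simp only [ind_iff_of_reps hA h, ind_iff_of_reps hA' h']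

lemma Spec.of_reps [NeZero n] {d' : ℕ} {A : Matrix (Fin d) (Fin n) ℝ}
    {A' : Matrix (Fin d') (Fin n) ℝ}
    (hA : A.rank = d) (hA' : A'.rank = d') {P : Finset (Fin n) → Prop} (h : A.RepresentsBases P)
    (h' : A'.RepresentsBases P) {g : ℕ → ℕ} (hs : Spec (cols A) g) : Spec (cols A') g :=
  ⟨hs.1, fun k m hkm => by rw [← span_iff_of_reps hA hA' h h']; exact hs.2 k m hkm⟩

lemma Spec.ext [NeZero n] {v : Fin n → Fin d → ℝ} {g g' : ℕ → ℕ} (h : Spec v g) (h' : Spec v g') :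
    g = g' := by
  funext k
  apply le_antisymm
  · rw [← h.2 k _ (h'.1 k), h'.2 k _ (h'.1 k)]
  · rw [← h'.2 k _ (h.1 k), h.2 k _ (h.1 k)]

lemma arc_self [NeZero n] (i : ℕ) : arc n i i = ∅ := by
  ext x; simp only [mem_arc, Set.mem_empty_iff_false, iff_false]; rintro ⟨k, _, _, _⟩; omega

lemma arc_mono [NeZero n] {i j i' j' : ℕ} (h1 : i' ≤ i) (h2 : j ≤ j') : arc n i j ⊆ arc n i' j' := by
  rintro x ⟨k, h3, h4, h5⟩; exact ⟨k, by omega, by omega, h5⟩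

lemma arc_succ [NeZero n] {i j : ℕ} (h : i ≤ j) :
    arc n i (j + 1) = insert (ix n (j + 1)) (arc n i j) := by
  ext x; rw [Set.mem_insert_iff]; constructor
  · rintro ⟨k, h1, h2, rfl⟩
    by_cases hk : k = j + 1
    · left; rw [hk]
    · right; exact ⟨k, h1, by omega, rfl⟩
  · rintro (rfl | ⟨k, h1, h2, rfl⟩)
    · exact ⟨j + 1, by omega, le_rfl, rfl⟩
    · exact ⟨k, h1, by omega, rfl⟩

lemma arc_pred [NeZero n] {i j : ℕ} (h : i < j) :
    arc n i j = insert (ix n (i + 1)) (arc n (i + 1) j) := by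
  ext x; rw [Set.mem_insert_iff]; constructor
  · rintro ⟨k, h1, h2, rfl⟩
    by_cases hk : k = i + 1
    · left; rw [hk]
    · right; exact ⟨k, by omega, by omega, rfl⟩
  · rintro (rfl | ⟨k, h1, h2, rfl⟩)
    · exact ⟨i + 1, by omega, by omega, rfl⟩
    · exact ⟨k, by omega, by omega, rfl⟩

lemma exists_spec [NeZero n] (v : Fin n → Fin d → ℝ) : ∃ g, Spec v g := by
  classical
  have hex : ∀ k, ∃ m, k ≤ m ∧ v (ix n k) ∈ Submodule.span ℝ (v '' arc n k m) := fun k =>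
    ⟨k + n, by omega, Submodule.subset_span ⟨_, by rw [arc_full]; trivial, rfl⟩⟩
  refine ⟨fun k => Nat.find (hex k), fun k => (Nat.find_spec (hex k)).1, fun k m hkm => ?_⟩
  constructor
  · intro h; exact Nat.find_min' _ ⟨hkm, h⟩
  · intro h
    exact Submodule.span_mono (Set.image_mono (arc_mono le_rfl h)) (Nat.find_spec (hex k)).2

lemma Spec.le [NeZero n] {v : Fin n → Fin d → ℝ} {g : ℕ → ℕ} (h : Spec v g) (k : ℕ) :
    g k ≤ k + n :=
  (h.2 k _ (by omega)).1 (Submodule.subset_span ⟨_, by rw [arc_full]; trivial, rfl⟩)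

lemma Spec.per [NeZero n] {v : Fin n → Fin d → ℝ} {g : ℕ → ℕ} (h : Spec v g) (k : ℕ) :
    g (k + n) = g k + n := by
  have key : ∀ m, k ≤ m → (g (k + n) ≤ m + n ↔ g k ≤ m) := by
    intro m hm
    rw [← h.2 k m hm, ← h.2 _ _ (by omega), ix_add_one]
    have := arc_shift (n := n) k m 1
    rw [one_mul] at this
    rw [this]
  have h1 := (key _ (h.1 k)).2 le_rfl
  have h2 := (key (g (k + n) - n) (by have := h.1 (k + n); omega)).1
    (by have := h.1 (k + n); omega)
  have := h.1 (k + n)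
  omega

lemma Spec.inj [NeZero n] {v : Fin n → Fin d → ℝ} {g : ℕ → ℕ} (h : Spec v g) :
    Function.Injective g := by
  have key : ∀ i j, i < j → g i ≠ g j := by
    intro i j hij hg
    obtain ⟨m, hm⟩ : ∃ m, g j = m + 1 := ⟨g j - 1, by have := h.1 j; omega⟩
    have hjm := h.1 j
    have h1 : v (ix n (m + 1)) ∈ Submodule.span ℝ (v '' arc n i m) := by
      by_cases hj : j = m + 1
      · have := (h.2 j j le_rfl).2 (by omega)
        rw [arc_self, Set.image_empty, Submodule.span_empty, Submodule.mem_bot, hj] at this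
        rw [this]; exact Submodule.zero_mem _
      · have h2 := (h.2 j (m + 1) (by omega)).2 (by omega)
        have h3 := mt (h.2 j m (by omega)).1 (by omega)
        rw [arc_succ (by omega), Set.image_insert_eq] at h2
        have h4 := mem_span_insert_exchange h2 h3
        rw [← Set.image_insert_eq] at h4
        refine Submodule.span_mono (Set.image_mono ?_) h4
        rw [Set.insert_subset_iff]
        exact ⟨⟨j, hij, by omega, rfl⟩, arc_mono hij.le le_rfl⟩
    have h2 := (h.2 i (m + 1) (by omega)).2 (by omega)
    rw [arc_succ (by omega), Set.image_insert_eq, Submodule.span_insert_eq_span h1,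
      h.2 i m (by omega)] at h2
    omega
  intro i j hij
  by_contra hne
  rcases lt_or_gt_of_ne hne with hl | hl
  · exact key i j hl hij
  · exact key j i hl hij.symm

/-- Counting function computing ranks of arcs. -/
def cnt (g : ℕ → ℕ) (i j : ℕ) : ℕ := ((Finset.Ioc i j).filter (fun k => j < g k)).card

lemma Spec.rk_arc [NeZero n] {v : Fin n → Fin d → ℝ} {g : ℕ → ℕ} (h : Spec v g) (i j : ℕ)
    (hij : i ≤ j) : rk v (arc n i j) = cnt g i j := by
  obtain ⟨t, rfl⟩ := Nat.exists_eq_add_of_le hij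
  clear hij
  induction t generalizing i with
  | zero => simp [arc_self, rk_empty, cnt]
  | succ t ih =>
    have ih := ih (i + 1)
    rw [show i + 1 + t = i + (t + 1) by omega] at ih
    rw [arc_pred (by omega)]
    have hI : Finset.Ioc i (i + (t + 1)) = insert (i + 1) (Finset.Ioc (i + 1) (i + (t + 1))) := by
      ext x; simp only [Finset.mem_insert, Finset.mem_Ioc]; omega
    have hs := h.2 (i + 1) (i + (t + 1)) (by omega)
    unfold cnt at ih ⊢
    rw [hI, Finset.filter_insert]
    split_ifs with hc
    · rw [rk_insert_notMem v (mt hs.1 (Nat.not_le.2 hc)), ih, Finset.card_insert_of_notMem (by simp)]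
    · rw [rk_insert_mem v (hs.2 (Nat.not_lt.1 hc)), ih]

lemma spec_basis_iff [NeZero n] {A : Matrix (Fin d) (Fin n) ℝ} (hA : A.TotallyNonneg) {g : ℕ → ℕ}
    (hs : Spec (cols A) g) (B : Finset (Fin n)) :
    (B.card = d ∧ ind (cols A) B) ↔ B.card = cnt g 0 n ∧ ∀ i j, i ≤ j → j ≤ i + n →
      ((B : Set (Fin n)) ∩ arc n i j).ncard ≤ cnt g i j := by
  classical
  have hd : cnt g 0 n = d := by
    rw [← hs.rk_arc 0 n (by omega)]
    have := arc_full (n := n) 0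
    rw [zero_add] at this; rw [this]
    exact rk_univ (cols A) (span_of_rank hA.1)
  rw [hd]
  refine and_congr_right fun hB => ?_
  constructor
  · intro h i j h1 h2
    rw [← hs.rk_arc i j h1]
    have h3 : ind (cols A) (B.filter (fun x => x ∈ arc n i j)) := h.subset (Finset.filter_subset _ _)
    have h4 : (B : Set (Fin n)) ∩ arc n i j = (B.filter (fun x => x ∈ arc n i j) : Finset (Fin n)) := by
      ext; simp
    rw [h4, Set.ncard_coe_finset, ← h3]
    exact rk_mono _ (by intro x; simp)
  · intro h
    unfold ind
    rw [hB]
    refine basis_of_arcs hA _ (by rw [Set.ncard_coe_finset, hB]) fun i j h1 h2 => ?_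
    rw [hs.rk_arc i j h1]
    exact h i j h1 h2

lemma spec_sep [NeZero n] {A : Matrix (Fin d) (Fin n) ℝ} (hA : A.rank = d) {g : ℕ → ℕ}
    (hs : Spec (cols A) g) (i j : ℕ) (hij : i < j) (hj : j < i + n) :
    rk (cols A) (arc n i j) + rk (cols A) (arc n j (i + n)) = d ↔
      ∀ k, i < k → k ≤ j → ix n (g k) ∈ arc n i j := by
  have hd : cnt g i (i + n) = d := by
    rw [← hs.rk_arc i _ (by omega), arc_full]
    exact rk_univ (cols A) (span_of_rank hA)
  have e1 : cnt g i (i + n) = ((Finset.Ioc i j).filter (fun k => i + n < g k)).card +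
      cnt g j (i + n) := by
    unfold cnt
    rw [← Finset.card_union_of_disjoint, ← Finset.filter_union, Finset.Ioc_union_Ioc_eq_Ioc hij.le hj.le]
    rw [Finset.disjoint_left]; intro x; simp; omega
  have hsub : (Finset.Ioc i j).filter (fun k => i + n < g k) ⊆
      (Finset.Ioc i j).filter (fun k => j < g k) := by
    intro x; simp; intros; omega
  have e2 : (rk (cols A) (arc n i j) + rk (cols A) (arc n j (i + n)) = d) ↔
      (Finset.Ioc i j).filter (fun k => i + n < g k) =
      (Finset.Ioc i j).filter (fun k => j < g k) := by
    rw [hs.rk_arc i j hij.le, hs.rk_arc j _ hj.le, ← hd, e1]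
    constructor
    · intro h; exact Finset.eq_of_subset_of_card_le hsub (by unfold cnt at h; omega)
    · intro h; rw [h]; rfl
  rw [e2, Finset.ext_iff]
  refine forall_congr' fun k => ?_
  simp only [Finset.mem_filter, Finset.mem_Ioc]
  have h1 := hs.1 k
  have h2 := hs.le k
  constructor
  · intro h h3 h4
    by_cases h5 : g k ≤ j
    · exact ⟨g k, by omega, h5, rfl⟩
    · refine ⟨g k - n, by omega, by omega, ?_⟩
      rw [← ix_add_one]; congr 1; omega
  · intro h
    constructor
    · rintro ⟨h3, h4⟩; exact ⟨h3, by omega⟩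
    · rintro ⟨⟨h3, h4⟩, h5⟩
      refine ⟨⟨h3, h4⟩, ?_⟩
      by_contra hc
      obtain ⟨l, l1, l2, l3⟩ := h h3 h4
      have := ix_inj l3 (by omega) (by omega)
      omega

lemma conn_iff {A : Matrix (Fin d) (Fin n) ℝ} (hA : A.rank = d) {P : Finset (Fin n) → Prop}
    (h : A.RepresentsBases P) : MatroidConnected P ↔ ¬ ∃ F : Set (Fin n), F.Nonempty ∧ Fᶜ.Nonempty ∧
      rk (cols A) F + rk (cols A) Fᶜ = d := by
  classical
  have hu : rk (cols A) Set.univ = d := rk_univ _ (span_of_rank hA)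
  unfold MatroidConnected
  rw [not_iff_not]
  constructor
  · rintro ⟨E1, E2, P1, P2, hE1, hE2, hdis, hun, hP1, hP2, hs1, hs2, hP⟩
    have hc : (E1 : Set (Fin n))ᶜ = E2 := by
      ext x
      have h1 : x ∈ E1 ∪ E2 := by rw [hun]; simp
      have h2 : x ∈ E1 → x ∉ E2 := fun hx => Finset.disjoint_left.1 hdis hx
      simp only [Set.mem_compl_iff, Finset.mem_coe]
      rw [Finset.mem_union] at h1; tauto
    refine ⟨E1, hE1, by rw [hc]; exact hE2, ?_⟩
    rw [hc]
    obtain ⟨I1, hI1, hi1, hc1⟩ := exists_ind_base (cols A) E1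
    obtain ⟨I2, hI2, hi2, hc2⟩ := exists_ind_base (cols A) E2
    have key1 : ∃ B1, P1 B1 ∧ rk (cols A) E1 ≤ B1.card := by
      obtain ⟨B, h1, h2, h3⟩ := exists_basis_ext (cols A) hu hi1
      obtain ⟨B1, B2, h4, h5, h6⟩ := (hP B).1 ((reps_iff h B).2 ⟨h3, h2⟩)
      refine ⟨B1, h4, ?_⟩
      rw [← hc1]
      refine Finset.card_le_card fun x hx => ?_
      have h7 := h1 hx
      rw [h6, Finset.mem_union] at h7
      rcases h7 with h7 | h7
      · exact h7
      · exact absurd (hs2 _ h5 h7) (Finset.disjoint_left.1 hdis (hI1 hx))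
    have key2 : ∃ B2, P2 B2 ∧ rk (cols A) E2 ≤ B2.card := by
      obtain ⟨B, h1, h2, h3⟩ := exists_basis_ext (cols A) hu hi2
      obtain ⟨B1, B2, h4, h5, h6⟩ := (hP B).1 ((reps_iff h B).2 ⟨h3, h2⟩)
      refine ⟨B2, h5, ?_⟩
      rw [← hc2]
      refine Finset.card_le_card fun x hx => ?_
      have h7 := h1 hx
      rw [h6, Finset.mem_union] at h7
      rcases h7 with h7 | h7
      · exact absurd (hI2 hx) (Finset.disjoint_left.1 hdis (hs1 _ h4 h7))
      · exact h7
    obtain ⟨B1, h1, h2⟩ := key1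
    obtain ⟨B2, h3, h4⟩ := key2
    have h5 := ((reps_iff h _).1 ((hP (B1 ∪ B2)).2 ⟨B1, B2, h1, h3, rfl⟩)).1
    rw [Finset.card_union_of_disjoint
      (Finset.disjoint_of_subset_left (hs1 _ h1) (Finset.disjoint_of_subset_right (hs2 _ h3) hdis))] at h5
    have h6 := rk_union_le (cols A) E1 E2
    rw [← Finset.coe_union, hun, Finset.coe_univ, hu] at h6
    omega
  · rintro ⟨F, hF, hF', hr⟩
    have hbs : ∀ E : Finset (Fin n), IsBasesSet
        (fun B => B ⊆ E ∧ ind (cols A) B ∧ B.card = rk (cols A) E) := by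
      intro E
      refine ⟨exists_ind_base (cols A) E, ?_⟩
      rintro B1 B2 ⟨h1, h2, h3⟩ ⟨h4, h5, h6⟩ b1 hb1
      rw [Finset.mem_sdiff] at hb1
      have h7 := h2.subset (Finset.erase_subset b1 B1)
      have h8 : ∃ b2 ∈ B2, cols A b2 ∉
          Submodule.span ℝ (cols A '' ((B1.erase b1 : Finset (Fin n)) : Set (Fin n))) := by
        by_contra hcon
        push Not at hcon
        have h9 : rk (cols A) (B2 : Set (Fin n)) ≤ rk (cols A) (B1.erase b1 : Finset (Fin n)) := by
          apply Submodule.finrank_mono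
          rw [Submodule.span_le]
          rintro _ ⟨x, hx, rfl⟩
          exact hcon x hx
        rw [h7, h5, Finset.card_erase_of_mem hb1.1] at h9
        have := Finset.card_pos.2 ⟨b1, hb1.1⟩
        omega
      obtain ⟨b2, hb2, hb2'⟩ := h8
      have hb3 : b2 ∉ B1.erase b1 := fun h => hb2' (Submodule.subset_span ⟨_, h, rfl⟩)
      have hb4 : b2 ∉ B1 := fun h => hb3 (Finset.mem_erase.2 ⟨by rintro rfl; exact hb1.2 hb2, h⟩)
      refine ⟨b2, Finset.mem_sdiff.2 ⟨hb2, hb4⟩, ?_, ind_insert h7 hb2', ?_⟩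
      · exact Finset.insert_subset (h4 hb2) ((Finset.erase_subset _ _).trans h1)
      · rw [Finset.card_insert_of_notMem hb3, Finset.card_erase_add_one hb1.1, h3]
    refine ⟨F.toFinset, Fᶜ.toFinset, _, _, Set.toFinset_nonempty.2 hF, Set.toFinset_nonempty.2 hF', ?_, ?_,
      hbs F.toFinset, hbs Fᶜ.toFinset, fun B hB => hB.1, fun B hB => hB.1, ?_⟩
    · rw [Finset.disjoint_left]; intro x; simp
    · ext x; simp
    · intro B
      simp only [Set.coe_toFinset]
      rw [reps_iff h]
      constructor
      · rintro ⟨h1, h2⟩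
        have h3 := h2.subset (Finset.filter_subset (fun x => x ∈ F) B)
        have h4 := h2.subset (Finset.filter_subset (fun x => ¬ x ∈ F) B)
        have h5 := Finset.card_filter_add_card_filter_not (s := B) (fun x => x ∈ F)
        have h6 : rk (cols A) (B.filter (fun x => x ∈ F) : Finset (Fin n)) ≤ rk (cols A) F :=
          rk_mono _ (by intro x; simp)
        have h7 : rk (cols A) (B.filter (fun x => ¬ x ∈ F) : Finset (Fin n)) ≤ rk (cols A) Fᶜ :=
          rk_mono _ (by intro x; simp)
        rw [h3] at h6
        rw [h4] at h7
        refine ⟨_, _, ⟨?_, h3, by omega⟩, ⟨?_, h4, by omega⟩, ?_⟩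
        · intro x; simp
        · intro x; simp
        · rw [Finset.filter_union_filter_not_eq]
      · rintro ⟨B1, B2, ⟨h1, h2, h3⟩, ⟨h4, h5, h6⟩, rfl⟩
        have hdis : Disjoint B1 B2 := by
          rw [Finset.disjoint_left]; intro x hx hx'
          have := h1 hx; have := h4 hx'; simp_all
        have hcard : (B1 ∪ B2).card = d := by rw [Finset.card_union_of_disjoint hdis]; omega
        refine ⟨hcard, ?_⟩
        have s1 : Submodule.span ℝ (cols A '' (B1 : Set (Fin n))) = Submodule.span ℝ (cols A '' F) := by
          refine Submodule.eq_of_le_of_finrank_eq (Submodule.span_mono (Set.image_mono ?_)) ?_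
          · intro x hx; simpa using h1 hx
          · exact h2.trans h3
        have s2 : Submodule.span ℝ (cols A '' (B2 : Set (Fin n))) = Submodule.span ℝ (cols A '' Fᶜ) := by
          refine Submodule.eq_of_le_of_finrank_eq (Submodule.span_mono (Set.image_mono ?_)) ?_
          · intro x hx; simpa using h4 hx
          · exact h5.trans h6
        unfold ind
        rw [hcard]
        refine Eq.trans ?_ hu
        unfold rk
        rw [Finset.coe_union, Set.image_union, Submodule.span_union, s1, s2, ← Submodule.span_union,
          ← Set.image_union, Set.union_compl_self]

/-- Connectedness in terms of the affine permutation. -/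
lemma conn_iff_spec [NeZero n] {A : Matrix (Fin d) (Fin n) ℝ} (hA : A.TotallyNonneg)
    {P : Finset (Fin n) → Prop} (h : A.RepresentsBases P) {g : ℕ → ℕ} (hs : Spec (cols A) g) :
    MatroidConnected P ↔ ¬ ∃ i j, i < j ∧ j < i + n ∧ ∀ k, i < k → k ≤ j → ix n (g k) ∈ arc n i j := by
  rw [conn_iff hA.1 h, not_iff_not]
  constructor
  · rintro ⟨F, h1, h2, h3⟩
    obtain ⟨l, m, h4, h5, h6⟩ := exists_arc_sep hA F h1 h2 h3
    exact ⟨l, m, h4, h5, (spec_sep hA.1 hs l m h4 h5).1 h6⟩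
  · rintro ⟨i, j, h4, h5, h6⟩
    have h7 := (spec_sep hA.1 hs i j h4 h5).2 h6
    rw [← arc_compl h4.le h5.le] at h7
    refine ⟨arc n i j, ⟨_, j, h4, le_rfl, rfl⟩, ?_, h7⟩
    rw [arc_compl h4.le h5.le]
    exact ⟨_, i + n, h5, le_rfl, rfl⟩

end Pos

namespace Pos

variable {d n : ℕ}

/-- Bounded affine permutations. -/
structure Bd (n : ℕ) (g : ℕ → ℕ) : Prop where
  ge : ∀ k, k ≤ g k
  le : ∀ k, g k ≤ k + n
  per : ∀ k, g (k + n) = g k + n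
  inj : Function.Injective g

lemma Spec.bd [NeZero n] {v : Fin n → Fin d → ℝ} {g : ℕ → ℕ} (h : Spec v g) : Bd n g :=
  ⟨h.1, h.le, h.per, h.inj⟩

lemma Bd.per_mul {g : ℕ → ℕ} (h : Bd n g) (k q : ℕ) : g (k + q * n) = g k + q * n := by
  induction q with
  | zero => simp
  | succ q ih => rw [add_mul, one_mul, ← add_assoc, h.per, ih, add_assoc]

lemma Bd.ix_inj [NeZero n] {g : ℕ → ℕ} (h : Bd n g) {a b : ℕ} (hab : ix n (g a) = ix n (g b)) :
    ix n a = ix n b := by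
  rcases le_total (g a) (g b) with hl | hl
  · obtain ⟨q, hq⟩ := ix_eq_shift hab hl
    rw [← h.per_mul] at hq
    rw [h.inj hq, ix_add]
  · obtain ⟨q, hq⟩ := ix_eq_shift hab.symm hl
    rw [← h.per_mul] at hq
    rw [h.inj hq, ix_add]

/-- Swapping two residue classes. -/
def sw (n i j k : ℕ) : ℕ :=
  if k % n = i then k + (j - i) else if k % n = j then k - (j - i) else k

lemma mod_form {k r : ℕ} (h : k % n = r) : ∃ q, k = r + q * n :=
  ⟨k / n, by have := Nat.div_add_mod k n; rw [mul_comm]; omega⟩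

lemma form_mod {q r : ℕ} (h : r < n) : (r + q * n) % n = r := by
  rw [Nat.add_mul_mod_self_right, Nat.mod_eq_of_lt h]

lemma sw_left {i j : ℕ} (hij : i < j) (hj : j < n) (q : ℕ) : sw n i j (i + q * n) = j + q * n := by
  unfold sw; rw [if_pos (form_mod (by omega))]; omega

lemma sw_right {i j : ℕ} (hij : i < j) (hj : j < n) (q : ℕ) : sw n i j (j + q * n) = i + q * n := by
  unfold sw; rw [form_mod hj, if_neg (by omega), if_pos rfl]; omega

lemma sw_other {i j k : ℕ} (h1 : k % n ≠ i) (h2 : k % n ≠ j) : sw n i j k = k := by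
  unfold sw; rw [if_neg h1, if_neg h2]

lemma sw_cases {i j : ℕ} (k : ℕ) : (∃ q, k = i + q * n) ∨ (∃ q, k = j + q * n) ∨
    (k % n ≠ i ∧ k % n ≠ j) := by
  by_cases h1 : k % n = i
  · exact Or.inl (mod_form h1)
  · by_cases h2 : k % n = j
    · exact Or.inr (Or.inl (mod_form h2))
    · exact Or.inr (Or.inr ⟨h1, h2⟩)

lemma sw_sw {i j : ℕ} (hij : i < j) (hj : j < n) (k : ℕ) : sw n i j (sw n i j k) = k := by
  rcases sw_cases (n := n) (i := i) (j := j) k with ⟨q, rfl⟩ | ⟨q, rfl⟩ | ⟨h1, h2⟩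
  · rw [sw_left hij hj, sw_right hij hj]
  · rw [sw_right hij hj, sw_left hij hj]
  · rw [sw_other h1 h2, sw_other h1 h2]

/-- A good place to split off a bridge. -/
structure Bridge (n : ℕ) (g : ℕ → ℕ) (i j : ℕ) : Prop where
  lt : i < j
  lt' : j < n
  lo : j ≤ g i
  lt'' : g i < g j
  hi : g j ≤ i + n
  fix : ∀ k, i < k → k < j → g k = k ∨ g k = k + n

lemma Bd.bridge [NeZero n] {g : ℕ → ℕ} (h : Bd n g)
    (hne : ∃ k < n, g k ≠ k ∧ g k ≠ k + n) : ∃ i j, Bridge n g i j := by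
  classical
  have hn : 0 < n := Nat.pos_of_ne_zero (NeZero.ne n)
  set S := (Finset.range n).filter (fun k => g k ≠ k ∧ g k ≠ k + n) with hS
  have memS : ∀ k, k ∈ S ↔ k < n ∧ g k ≠ k ∧ g k ≠ k + n := by intro k; simp [hS]
  have hSn : S.Nonempty := by obtain ⟨k, h1, h2⟩ := hne; exact ⟨k, (memS k).2 ⟨h1, h2⟩⟩
  have hnf : ∀ b ∈ S, ∀ k, k < n → ix n (g b) = ix n k → k ∈ S := by
    intro b hb k hk he
    by_contra hkS
    have h1 : g k = k ∨ g k = k + n := by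
      by_contra hc; push Not at hc; exact hkS ((memS k).2 ⟨hk, hc⟩)
    have h2 : ix n (g k) = ix n k := by
      rcases h1 with h1 | h1 <;> rw [h1]
      exact ix_add_one k
    have h3 := h.ix_inj (he.trans h2.symm)
    rw [ix_eq_iff, Nat.mod_eq_of_lt hk, Nat.mod_eq_of_lt ((memS b).1 hb).1] at h3
    exact hkS (h3 ▸ hb)
  set a := S.min' hSn
  set b := S.max' hSn
  have haS : a ∈ S := S.min'_mem hSn
  have hbS : b ∈ S := S.max'_mem hSn
  have hgb : a + n ≤ g b := by
    have h1 := hnf b hbS (g b % n) (Nat.mod_lt _ hn) (by rw [ix_eq_iff]; simp)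
    have h2 := S.min'_le _ h1
    have h3 := S.le_max' _ h1
    have h4 := h.ge b
    have h5 := ((memS b).1 hbS).2.1
    obtain ⟨q, hq⟩ := mod_form (n := n) (k := g b) rfl
    rcases q with _ | q
    · omega
    · rw [add_mul, one_mul] at hq
      change a ≤ _ at h2
      omega
  have hga : g a < a + n := by have := h.le a; have := ((memS a).1 haS).2.2; omega
  have hT : (S.filter (fun k => g a < g k)).Nonempty := ⟨b, by rw [Finset.mem_filter]; exact ⟨hbS, by omega⟩⟩
  set j := (S.filter (fun k => g a < g k)).min' hT
  have hj := (S.filter (fun k => g a < g k)).min'_mem hT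
  rw [Finset.mem_filter] at hj
  change j ∈ S ∧ g a < g j at hj
  have haj : a < j := by
    have h1 : a ≤ j := S.min'_le _ hj.1
    rcases h1.lt_or_eq with h1 | h1
    · exact h1
    · rw [← h1] at hj; omega
  have hU : (S.filter (fun k => k < j)).Nonempty := ⟨a, by rw [Finset.mem_filter]; exact ⟨haS, haj⟩⟩
  set i := (S.filter (fun k => k < j)).max' hU
  have hi := (S.filter (fun k => k < j)).max'_mem hU
  rw [Finset.mem_filter] at hi
  change i ∈ S ∧ i < j at hi
  have hgi : g i ≤ g a := by
    by_contra hc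
    have := (S.filter (fun k => g a < g k)).min'_le i
      (by rw [Finset.mem_filter]; exact ⟨hi.1, by omega⟩)
    change j ≤ i at this
    omega
  have hbet : ∀ k, i < k → k < j → k ∉ S := by
    intro k h1 h2 h3
    have := (S.filter (fun k => k < j)).le_max' k (by rw [Finset.mem_filter]; exact ⟨h3, h2⟩)
    change k ≤ i at this
    omega
  have hiS := (memS i).1 hi.1
  have hjS := (memS j).1 hj.1
  have g1 := h.ge i
  have g2 := h.le j
  refine ⟨i, j, hi.2, hjS.1, ?_, by omega, ?_, ?_⟩
  · by_contra hc
    exact hbet (g i) (by omega) (by omega) (hnf i hi.1 _ (by omega) rfl)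
  · by_contra hc
    refine hbet (g j - n) (by omega) (by omega) (hnf j hj.1 _ (by omega) ?_)
    rw [← ix_add_one (g j - n)]; congr 1; omega
  · intro k h1 h2
    by_contra hc; push Not at hc
    exact hbet k h1 h2 ((memS k).2 ⟨by omega, hc⟩)

lemma Bd.swap {g : ℕ → ℕ} (h : Bd n g) {i j : ℕ} (hb : Bridge n g i j) :
    Bd n (fun k => g (sw n i j k)) := by
  have hij := hb.lt
  have hj := hb.lt'
  have h1 := hb.lo
  have h2 := hb.lt''
  have h3 := hb.hi
  refine ⟨fun k => ?_, fun k => ?_, fun k => ?_, ?_⟩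
  · rcases sw_cases (n := n) (i := i) (j := j) k with ⟨q, rfl⟩ | ⟨q, rfl⟩ | ⟨h4, h5⟩
    · simp only [sw_left hij hj, h.per_mul]; omega
    · simp only [sw_right hij hj, h.per_mul]; omega
    · simp only [sw_other h4 h5]; exact h.ge k
  · rcases sw_cases (n := n) (i := i) (j := j) k with ⟨q, rfl⟩ | ⟨q, rfl⟩ | ⟨h4, h5⟩
    · simp only [sw_left hij hj, h.per_mul]; omega
    · simp only [sw_right hij hj, h.per_mul]; omega
    · simp only [sw_other h4 h5]; exact h.le k
  · have e : ∀ r q, r + q * n + n = r + (q + 1) * n := by intros; ring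
    rcases sw_cases (n := n) (i := i) (j := j) k with ⟨q, rfl⟩ | ⟨q, rfl⟩ | ⟨h4, h5⟩
    · simp only [e, sw_left hij hj, h.per_mul]
    · simp only [e, sw_right hij hj, h.per_mul]
    · simp only [sw_other h4 h5]
      rw [sw_other (by simpa using h4) (by simpa using h5)]; exact h.per k
  · intro a b hab
    have := h.inj hab
    rw [← sw_sw hij hj a, this, sw_sw hij hj]

lemma swap_measure {g : ℕ → ℕ} {i j : ℕ} (hb : Bridge n g i j) :
    ∑ k ∈ Finset.range n, k * g (sw n i j k) < ∑ k ∈ Finset.range n, k * g k := by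
  have hij := hb.lt
  have hj := hb.lt'
  have h2 := hb.lt''
  have hi : i ∈ Finset.range n := by rw [Finset.mem_range]; omega
  have hj' : j ∈ (Finset.range n).erase i := by
    rw [Finset.mem_erase, Finset.mem_range]; omega
  rw [← Finset.add_sum_erase _ _ hi, ← Finset.add_sum_erase _ _ hj',
    ← Finset.add_sum_erase _ (fun k => k * g k) hi, ← Finset.add_sum_erase _ (fun k => k * g k) hj']
  have e : ∑ x ∈ ((Finset.range n).erase i).erase j, x * g (sw n i j x) =
      ∑ x ∈ ((Finset.range n).erase i).erase j, x * g x := by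
    refine Finset.sum_congr rfl fun x hx => ?_
    simp only [Finset.mem_erase, Finset.mem_range] at hx
    rw [sw_other] <;> rw [Nat.mod_eq_of_lt hx.2.2] <;> omega
  rw [e]
  have e1 := sw_left hij hj 0
  have e2 := sw_right hij hj 0
  simp only [zero_mul, add_zero] at e1 e2
  rw [e1, e2]
  nlinarith

/-! ### The base case -/

lemma base_real [NeZero n] {g : ℕ → ℕ} (h : Bd n g) (hf : ∀ k < n, g k = k ∨ g k = k + n) :
    ∃ (d : ℕ) (A : Matrix (Fin d) (Fin n) ℝ), A.TotallyNonneg ∧ Spec (cols A) g := by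
  classical
  set C : Finset (Fin n) := univ.filter (fun k : Fin n => g k = k + n) with hC
  set em := C.orderEmbOfFin rfl with hem
  have hemC : ∀ r, em r ∈ C := fun r => Finset.orderEmbOfFin_mem C rfl r
  have hemS : ∀ x ∈ C, ∃ r, em r = x := by
    intro x hx
    have : x ∈ Set.range em := by rw [hem, Finset.range_orderEmbOfFin]; exact hx
    exact this
  let A : Matrix (Fin C.card) (Fin n) ℝ := Matrix.of fun r x => if em r = x then 1 else 0
  have hcz : ∀ x, x ∉ C → cols A x = 0 := by
    intro x hx
    funext r
    simp only [cols, A, Matrix.of_apply, Pi.zero_apply, ite_eq_right_iff, one_ne_zero, imp_false]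
    rintro rfl; exact hx (hemC r)
  have hcs : ∀ r, cols A (em r) = Pi.single r 1 := by
    intro r
    funext s
    simp only [cols, A, Matrix.of_apply, em.injective.eq_iff, Pi.single_apply]
  refine ⟨C.card, A, ⟨rank_of_span ?_, fun f hf' => ?_⟩, h.ge, fun k m hkm => ?_⟩
  · rw [eq_top_iff, ← (Pi.basisFun ℝ (Fin C.card)).span_eq, Submodule.span_le]
    rintro _ ⟨r, rfl⟩
    rw [Pi.basisFun_apply]
    exact Submodule.subset_span ⟨em r, hcs r⟩
  · by_cases hfC : ∀ r, f r ∈ C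
    · have : f = em := Finset.orderEmbOfFin_unique rfl hfC hf'
      have : A.submatrix id f = 1 := by
        ext r s
        simp only [A, this, Matrix.submatrix_apply, Matrix.of_apply, id, em.injective.eq_iff,
          Matrix.one_apply]
      rw [this]; simp
    · push Not at hfC
      obtain ⟨r, hr⟩ := hfC
      rw [Matrix.det_eq_zero_of_column_eq_zero r]
      intro s
      exact congrFun (hcz _ hr) s
  · obtain ⟨q, hq⟩ := mod_form (n := n) (k := k) rfl
    have hkn : k % n < n := Nat.mod_lt _ (Nat.pos_of_ne_zero (NeZero.ne n))
    have hgk : g k = g (k % n) + q * n := by conv_lhs => rw [hq, h.per_mul]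
    by_cases hx : ix n k ∈ C
    · have h1 : g (k % n) = k % n + n := by
        have := (Finset.mem_filter.1 hx).2
        rwa [ix_val] at this
      constructor
      · intro hm
        by_contra hcon
        obtain ⟨r, hr⟩ := hemS _ hx
        have h2 : Submodule.span ℝ (cols A '' arc n k m) ≤ LinearMap.ker (LinearMap.proj r) := by
          rw [Submodule.span_le]
          rintro _ ⟨y, ⟨l, l1, l2, rfl⟩, rfl⟩
          simp only [SetLike.mem_coe, LinearMap.mem_ker, LinearMap.proj_apply, cols, A,
            Matrix.of_apply, ite_eq_right_iff, one_ne_zero, imp_false]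
          intro he
          have := ix_inj (hr.symm.trans he) (by omega) (by omega)
          omega
        have h3 := h2 hm
        rw [← hr, hcs] at h3
        simp at h3
      · intro hm
        refine Submodule.subset_span ⟨_, ?_, rfl⟩
        exact ⟨k + n, by have := NeZero.pos n; omega, by omega, ix_add_one k⟩
    · have h1 : g (k % n) = k % n := by
        rcases hf _ hkn with h1 | h1
        · exact h1
        · exfalso; apply hx; rw [hC, Finset.mem_filter, ix_val]; exact ⟨mem_univ _, h1⟩
      rw [hcz _ hx]
      exact iff_of_true (Submodule.zero_mem _) (by omega)

/-! ### The bridge step -/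

/-- `k` is a loop or a coloop. -/
def Fixed (v : Fin n → Fin d → ℝ) (k : Fin n) : Prop :=
  v k = 0 ∨ v k ∉ Submodule.span ℝ (v '' {k}ᶜ)

lemma Fixed.elim {v : Fin n → Fin d → ℝ} {k x : Fin n} (h : Fixed v k) (hx : x ≠ k)
    {X : Set (Fin n)} (hk : k ∉ X) :
    v x ∈ Submodule.span ℝ (v '' (insert k X)) ↔ v x ∈ Submodule.span ℝ (v '' X) := by
  rw [Set.image_insert_eq]
  rcases h with h | h
  · rw [h, Submodule.span_insert_zero]
  · constructor
    · intro hm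
      by_contra hcon
      have := mem_span_insert_exchange hm hcon
      rw [← Set.image_insert_eq] at this
      refine h (Submodule.span_mono (Set.image_mono ?_) this)
      intro y hy
      rw [Set.mem_compl_iff, Set.mem_singleton_iff]
      rintro rfl
      rcases hy with hy | hy
      · exact hx hy.symm
      · exact hk hy
    · exact fun hm => Submodule.span_mono (Set.subset_insert _ _) hm

lemma Fixed.chain [NeZero n] {v : Fin n → Fin d → ℝ} {I J m : ℕ} (hIJ : I < J) (hJm : J ≤ m)
    (hm : m < I + n) (h : ∀ k, I < k → k < J → Fixed v (ix n k)) :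
    v (ix n I) ∈ Submodule.span ℝ (v '' arc n I m) ↔
      v (ix n I) ∈ Submodule.span ℝ (v '' arc n (J - 1) m) := by
  obtain ⟨t, rfl⟩ : ∃ t, J = I + 1 + t := ⟨J - I - 1, by omega⟩
  induction t with
  | zero => simp
  | succ t ih =>
    rw [ih (by omega) (by omega) (fun k h1 h2 => h k h1 (by omega))]
    rw [arc_pred (by omega)]
    have e : I + 1 + t - 1 + 1 = I + 1 + (t + 1) - 1 := by omega
    rw [e]
    apply Fixed.elim
    · exact h _ (by omega) (by omega)
    · intro he
      have := ix_inj he (by omega) (by omega)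
      omega
    · rintro ⟨l, l1, l2, l3⟩
      have := ix_inj l3.symm (by omega) (by omega)
      omega

lemma Spec.fixed [NeZero n] {v : Fin n → Fin d → ℝ} {g : ℕ → ℕ} (h : Spec v g) {k : ℕ}
    (hk : g k = k ∨ g k = k + n) : Fixed v (ix n k) := by
  have hn := NeZero.pos n
  rcases hk with hk | hk
  · left
    have := (h.2 k k le_rfl).2 (by omega)
    rwa [arc_self, Set.image_empty, Submodule.span_empty, Submodule.mem_bot] at this
  · right
    have := mt (h.2 k (k + n - 1) (by omega)).1 (by omega)
    convert this using 4
    rw [← compl_inj_iff, compl_compl, arc_compl (by omega) (by omega)]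
    ext x
    rw [Set.mem_singleton_iff]
    constructor
    · rintro rfl; exact ⟨k + n, by omega, le_rfl, ix_add_one k⟩
    · rintro ⟨l, l1, l2, rfl⟩
      rw [show l = k + n by omega, ix_add_one]

end Pos

namespace Pos

variable {d n : ℕ}

lemma upd_span_le (v : Fin n → Fin d → ℝ) (a b : Fin n) (τ : ℝ) (X : Set (Fin n))
    (h : b ∈ X → a ∈ X) : Submodule.span ℝ (Function.update v b (v b + τ • v a) '' X) ≤
      Submodule.span ℝ (v '' X) := by
  rw [Submodule.span_le]
  rintro _ ⟨x, hx, rfl⟩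
  by_cases hxb : x = b
  · subst hxb
    rw [Function.update_self]
    exact Submodule.add_mem _ (Submodule.subset_span ⟨_, hx, rfl⟩)
      (Submodule.smul_mem _ _ (Submodule.subset_span ⟨_, h hx, rfl⟩))
  · rw [Function.update_of_ne hxb]
    exact Submodule.subset_span ⟨_, hx, rfl⟩

lemma upd_span (v : Fin n → Fin d → ℝ) {a b : Fin n} (hab : a ≠ b) (τ : ℝ) (X : Set (Fin n))
    (h : b ∈ X → a ∈ X) : Submodule.span ℝ (Function.update v b (v b + τ • v a) '' X) =
      Submodule.span ℝ (v '' X) := by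
  refine le_antisymm (upd_span_le v a b τ X h) ?_
  have := upd_span_le (Function.update v b (v b + τ • v a)) a b (-τ) X h
  have e : Function.update (Function.update v b (v b + τ • v a)) b
      (Function.update v b (v b + τ • v a) b + -τ • Function.update v b (v b + τ • v a) a) = v := by
    rw [Function.update_self, Function.update_of_ne hab, Function.update_idem]
    simp
  rwa [e] at this

lemma upd_image (v : Fin n → Fin d → ℝ) {b : Fin n} (w : Fin d → ℝ) (X : Set (Fin n))
    (h : b ∉ X) : Function.update v b w '' X = v '' X := by
  refine Set.image_congr fun x hx => ?_
  rw [Function.update_of_ne]; rintro rfl; exact h hx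

lemma bridge_span {V : Type*} [AddCommGroup V] [Module ℝ V] (W : Set V) (x y : V) (τ : ℝ)
    (hτ : τ ≠ 0) (hxy : x ∈ Submodule.span ℝ (insert y W) → y ∈ Submodule.span ℝ W) :
    x ∈ Submodule.span ℝ (insert (y + τ • x) W) ↔ y ∈ Submodule.span ℝ W := by
  rw [Submodule.mem_span_insert] at hxy ⊢
  constructor
  · rintro ⟨c, z, hz, hx⟩
    by_cases hc : 1 - c * τ = 0
    · have hc0 : c ≠ 0 := by rintro rfl; simp at hc
      have h1 : c • y = -z := by
        have : (1 - c * τ) • x = c • y + z := by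
          rw [sub_smul, one_smul, mul_smul]; nth_rewrite 1 [hx]; rw [smul_add]; abel
        rw [hc, zero_smul] at this
        exact eq_neg_of_add_eq_zero_left this.symm
      have h2 : y = c⁻¹ • (-z) := by rw [← h1, smul_smul, inv_mul_cancel₀ hc0, one_smul]
      rw [h2]
      exact Submodule.smul_mem _ _ (Submodule.neg_mem _ hz)
    · apply hxy
      refine ⟨(1 - c * τ)⁻¹ * c, (1 - c * τ)⁻¹ • z, Submodule.smul_mem _ _ hz, ?_⟩
      have : (1 - c * τ) • x = c • y + z := by
        rw [sub_smul, one_smul, mul_smul]; nth_rewrite 1 [hx]; rw [smul_add]; abel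
      rw [mul_smul, ← smul_add, ← this, smul_smul, inv_mul_cancel₀ hc, one_smul]
  · intro hy
    refine ⟨τ⁻¹, -(τ⁻¹ • y), Submodule.neg_mem _ (Submodule.smul_mem _ _ hy), ?_⟩
    rw [smul_add, smul_smul, inv_mul_cancel₀ hτ, one_smul]; abel

lemma step_spec [NeZero n] {v : Fin n → Fin d → ℝ} {g : ℕ → ℕ} (hg : Bd n g) {i j : ℕ}
    (hb : Bridge n g i j) (hs : Spec v (fun k => g (sw n i j k))) (τ : ℝ) (hτ : τ ≠ 0) :
    Spec (Function.update v (ix n j) (v (ix n j) + τ • v (ix n i))) g := by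
  have hn := NeZero.pos n
  have hij := hb.lt
  have hj := hb.lt'
  have hlo := hb.lo
  have hlt := hb.lt''
  have hhi := hb.hi
  have hne : ix n i ≠ ix n j := by
    intro h; have := ix_inj h (by omega) (by omega); omega
  set u := Function.update v (ix n j) (v (ix n j) + τ • v (ix n i)) with hu
  have hsI : ∀ q m, i + q * n ≤ m →
      (v (ix n (i + q * n)) ∈ Submodule.span ℝ (v '' arc n (i + q * n) m) ↔ g j + q * n ≤ m) := by
    intro q m hm
    rw [hs.2 _ m hm]; simp only [sw_left hij hj, hg.per_mul]
  have hsJ : ∀ q m, j + q * n ≤ m →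
      (v (ix n (j + q * n)) ∈ Submodule.span ℝ (v '' arc n (j + q * n) m) ↔ g i + q * n ≤ m) := by
    intro q m hm
    rw [hs.2 _ m hm]; simp only [sw_right hij hj, hg.per_mul]
  have huI : u (ix n i) = v (ix n i) := by rw [hu, Function.update_of_ne hne]
  have huJ : u (ix n j) = v (ix n j) + τ • v (ix n i) := by rw [hu, Function.update_self]
  have hbet : ∀ q k, i + q * n < k → k < j + q * n → Fixed v (ix n k) ∧ Fixed u (ix n k) := by
    intro q k h1 h2
    have e0 : (k - q * n) % n = k - q * n := Nat.mod_eq_of_lt (by omega)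
    have e1 : ix n k = ix n (k - q * n) := by rw [← ix_add (k - q * n) q]; congr 1; omega
    have hfix := hb.fix (k - q * n) (by omega) (by omega)
    have hF : Fixed v (ix n k) := by
      rw [e1]
      apply hs.fixed
      rw [sw_other (by omega) (by omega)]
      exact hfix
    have hki : ix n k ≠ ix n i := by
      rw [e1]; intro h; have := ix_inj h.symm (by omega) (by omega); omega
    have hkj : ix n k ≠ ix n j := by
      rw [e1]; intro h; have := ix_inj h (by omega) (by omega); omega
    refine ⟨hF, ?_⟩
    rcases hF with hF | hF
    · left; rw [hu, Function.update_of_ne hkj, hF]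
    · right
      rw [hu, upd_span v hne τ _ (fun _ => by rw [Set.mem_compl_iff, Set.mem_singleton_iff]; exact hki.symm),
        Function.update_of_ne hkj]
      exact hF
  refine ⟨hg.ge, fun k m hkm => ?_⟩
  by_cases hmk : k + n ≤ m
  · refine iff_of_true (Submodule.subset_span ⟨_, ⟨k + n, by omega, hmk, ix_add_one k⟩, rfl⟩) ?_
    have := hg.le k; omega
  obtain ⟨q, hq⟩ := mod_form (n := n) (k := k) rfl
  have hkn : k % n < n := Nat.mod_lt _ hn
  set r := k % n with hr
  by_cases hri : r = i
  · -- the case of the lower endpoint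
    rw [hri] at hq
    subst hq
    have hgk : g (i + q * n) = g i + q * n := hg.per_mul i q
    rw [ix_add, huI, hgk]
    by_cases hmJ : m < j + q * n
    · rw [hu, upd_image]
      · have := hsI q m hkm
        rw [ix_add] at this
        rw [this]; omega
      · rintro ⟨l, l1, l2, l3⟩
        rw [← ix_add j q] at l3
        have := ix_inj l3 (by omega) (by omega)
        omega
    · have hc1 := Fixed.chain (v := v) (I := i + q * n) (J := j + q * n) (m := m) (by omega) (by omega)
        (by omega) (fun k h1 h2 => (hbet q k h1 h2).1)
      have hc2 := Fixed.chain (v := u) (I := i + q * n) (J := j + q * n) (m := m) (by omega) (by omega)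
        (by omega) (fun k h1 h2 => (hbet q k h1 h2).2)
      have e1 : arc n (j + q * n - 1) m = insert (ix n j) (arc n (j + q * n) m) := by
        rw [arc_pred (by omega), show j + q * n - 1 + 1 = j + q * n by omega, ix_add]
      rw [e1, ix_add, Set.image_insert_eq] at hc1 hc2
      rw [huI, huJ] at hc2
      have e2 : u '' arc n (j + q * n) m = v '' arc n (j + q * n) m := by
        rw [hu, upd_image]
        rintro ⟨l, l1, l2, l3⟩
        rw [← ix_add j q] at l3
        have := ix_inj l3.symm (by omega) (by omega)
        omega
      rw [e2] at hc2
      have h1 := hsI q m hkm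
      have h2 := hsJ q m (by omega)
      rw [ix_add] at h1 h2
      rw [hc2, bridge_span _ _ _ _ hτ, h2]
      rw [← hc1, h1, h2]; omega
  by_cases hrj : r = j
  · rw [hrj] at hq
    subst hq
    have hgk : g (j + q * n) = g j + q * n := hg.per_mul j q
    rw [ix_add, huJ, hgk]
    have hjn : ix n j ∉ arc n (j + q * n) m := by
      rintro ⟨l, l1, l2, l3⟩
      rw [← ix_add j q] at l3
      have := ix_inj l3.symm (by omega) (by omega)
      omega
    rw [hu, upd_image _ _ _ hjn]
    have h2 := hsJ q m (by omega)
    rw [ix_add] at h2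
    by_cases hmI : i + q * n + n ≤ m
    · have h3 : v (ix n i) ∈ Submodule.span ℝ (v '' arc n (j + q * n) m) :=
        Submodule.subset_span ⟨_, ⟨i + q * n + n, by omega, hmI, by rw [ix_add_one, ix_add]⟩, rfl⟩
      refine iff_of_true (Submodule.add_mem _ (h2.2 (by omega)) (Submodule.smul_mem _ _ h3)) (by omega)
    · have hc1 := Fixed.chain (v := v) (I := i + q * n) (J := j + q * n) (m := m) (by omega) (by omega)
        (by omega) (fun k h1 h2 => (hbet q k h1 h2).1)
      have e1 : arc n (j + q * n - 1) m = insert (ix n j) (arc n (j + q * n) m) := by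
        rw [arc_pred (by omega), show j + q * n - 1 + 1 = j + q * n by omega, ix_add]
      have h1 := hsI q m (by omega)
      rw [e1, ix_add, Set.image_insert_eq] at hc1
      rw [ix_add, hc1] at h1
      constructor
      · intro h
        rw [← h1, Submodule.mem_span_insert]
        refine ⟨-τ⁻¹, _, Submodule.smul_mem _ τ⁻¹ h, ?_⟩
        rw [smul_add, smul_smul, inv_mul_cancel₀ hτ, one_smul, neg_smul]; abel
      · intro h
        have h3 := h2.2 (by omega)
        have h4 := h1.2 h
        rw [Submodule.span_insert_eq_span h3] at h4
        exact Submodule.add_mem _ h3 (Submodule.smul_mem _ _ h4)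
  have hkj : ix n k ≠ ix n j := by
    rw [Ne, ix_eq_iff, Nat.mod_eq_of_lt hj]; exact hrj
  have hki : ix n k ≠ ix n i := by
    rw [Ne, ix_eq_iff, Nat.mod_eq_of_lt (show i < n by omega)]; exact hri
  have hsk : sw n i j k = k := sw_other hri hrj
  by_cases hbt : i < r ∧ r < j
  · have hF := (hbet q k (by omega) (by omega)).2
    have hgk : g k = g r + q * n := by rw [hq, hg.per_mul]
    have hfix := hb.fix r hbt.1 hbt.2
    have hFv := (hs.2 k m hkm)
    simp only [hsk] at hFv
    rcases hfix with h1 | h1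
    · have h2 := (hs.2 k k le_rfl).2 (by simp only [hsk]; omega)
      rw [arc_self, Set.image_empty, Submodule.span_empty, Submodule.mem_bot] at h2
      rw [hu, Function.update_of_ne hkj, h2]
      exact iff_of_true (Submodule.zero_mem _) (by omega)
    · refine iff_of_false (fun hm => ?_) (by omega)
      rcases hF with hF | hF
      · rw [hu, Function.update_of_ne hkj] at hF
        have := hFv.1 (by rw [hF]; exact Submodule.zero_mem _)
        omega
      · refine hF (Submodule.span_mono (Set.image_mono ?_) hm)
        rintro x ⟨l, l1, l2, rfl⟩
        rw [Set.mem_compl_iff, Set.mem_singleton_iff]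
        intro he
        have := ix_inj he.symm (by omega) (by omega)
        omega
  · have hFv := (hs.2 k m hkm)
    simp only [hsk] at hFv
    rw [← hFv, hu, upd_span v hne, Function.update_of_ne hkj]
    rintro ⟨l, l1, l2, l3⟩
    have e1 : l % n = j := by
      have := (ix_eq_iff _ _).1 l3
      rwa [Nat.mod_eq_of_lt hj] at this
    obtain ⟨q', rfl⟩ := mod_form e1
    have hq' : i + q' * n > k := by
      rcases lt_trichotomy q' q with hle | hle | hle
      · have := Nat.mul_le_mul_right n (show q' + 1 ≤ q by omega)
        rw [add_mul, one_mul] at this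
        omega
      · rw [hle] at l1 ⊢
        omega
      · have := Nat.mul_le_mul_right n (show q + 1 ≤ q' by omega)
        rw [add_mul, one_mul] at this
        omega
    exact ⟨i + q' * n, hq', by omega, ix_add i q'⟩

end Pos

namespace Pos

variable {d n : ℕ}

lemma dt_inj {A : Matrix (Fin d) (Fin n) ℝ} {f : Fin d → Fin n} (h : dt A f ≠ 0) :
    Function.Injective f := by
  intro a b hab
  by_contra hne
  exact h (Matrix.det_zero_of_column_eq hne (fun k => by simp [hab]))

lemma dt_span {A : Matrix (Fin d) (Fin n) ℝ} {f : Fin d → Fin n} (h : dt A f ≠ 0) :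
    Submodule.span ℝ (Set.range (fun q => cols A (f q))) = ⊤ := by
  have h1 : IsUnit (A.submatrix id f) := by
    rw [Matrix.isUnit_iff_isUnit_det]; exact isUnit_iff_ne_zero.2 h
  have h2 := Matrix.linearIndependent_cols_iff_isUnit.2 h1
  have h3 := h2.span_eq_top_of_card_eq_finrank' (by simp)
  exact h3

lemma dt_hit {A : Matrix (Fin d) (Fin n) ℝ} {f : Fin d → Fin n} (h : dt A f ≠ 0) {k : Fin n}
    (hk : cols A k ∉ Submodule.span ℝ (cols A '' {k}ᶜ)) : ∃ q, f q = k := by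
  by_contra hcon
  push Not at hcon
  apply hk
  have h1 : cols A k ∈ Submodule.span ℝ (Set.range (fun q => cols A (f q))) := by
    rw [dt_span h]; trivial
  refine Submodule.span_mono ?_ h1
  rintro _ ⟨q, rfl⟩
  exact ⟨f q, hcon q, rfl⟩

lemma dt_nonzero {A : Matrix (Fin d) (Fin n) ℝ} {f : Fin d → Fin n} (h : dt A f ≠ 0) (q : Fin d) :
    cols A (f q) ≠ 0 := by
  intro h0
  apply h
  exact Matrix.det_eq_zero_of_column_eq_zero q (fun i => congrFun h0 i)

lemma step_tn {A : Matrix (Fin d) (Fin n) ℝ} (hA : A.TotallyNonneg) (i j : Fin n) (hij : i < j)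
    (C : Finset (Fin n)) (hC : ∀ k ∈ C, i < k ∧ k < j ∧
      cols A k ∉ Submodule.span ℝ (cols A '' {k}ᶜ))
    (hL : ∀ k, i < k → k < j → k ∉ C → cols A k = 0) :
    (A.updateCol j (cols A j + (∏ k ∈ C, (((j : ℕ) : ℝ) - (k : ℕ)) * (((i : ℕ) : ℝ) - (k : ℕ))) •
      cols A i)).TotallyNonneg := by
  classical
  set τ := ∏ k ∈ C, (((j : ℕ) : ℝ) - (k : ℕ)) * (((i : ℕ) : ℝ) - (k : ℕ)) with hτ
  set A' := A.updateCol j (cols A j + τ • cols A i) with hA'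
  have hcol : cols A' = Function.update (cols A) j (cols A j + τ • cols A i) := by
    funext x r
    by_cases hx : x = j
    · subst hx; simp [cols, hA']
    · simp [cols, hA', hx]
  apply tn_of_nonneg
  · apply rank_of_span
    rw [hcol, ← Set.image_univ, upd_span _ hij.ne _ _ (fun _ => Set.mem_univ _), Set.image_univ]
    exact span_of_rank hA.1
  · intro f hf
    by_cases hp : ∃ p, f p = j
    · obtain ⟨p, hp⟩ := hp
      have e1 : dt A' f = dt A f + τ * dt A (Function.update f p i) := by
        unfold dt
        rw [submatrix_update]
        have e2 : A'.submatrix id f = (A.submatrix id f).updateCol p (cols A j + τ • cols A i) := by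
          ext r q
          by_cases hq : q = p
          · subst hq; simp [hA', hp]
          · have : f q ≠ j := fun h => hq (hf.injective (h.trans hp.symm))
            simp [hA', hq, this]
        rw [e2, Matrix.det_updateCol_add, Matrix.det_updateCol_smul]
        congr 2
        ext r q
        by_cases hq : q = p
        · subst hq; simp [cols, hp]
        · simp [hq]
      rw [e1, add_mul]
      refine add_nonneg (nonneg_all hA f) ?_
      set f' := Function.update f p i with hf'
      by_cases hD : dt A f' = 0
      · rw [hD]; simp
      · have hinj := dt_inj hD
        have hv : vd f' ≠ 0 := by
          unfold vd
          rw [Matrix.det_vandermonde_ne_zero_iff]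
          intro a b hab
          exact hinj (Fin.ext (Nat.cast_injective (R := ℝ) hab))
        obtain ⟨c, hc⟩ := vd_update f p
        have hc1 := hc j
        have hc2 := hc i
        rw [← hp, Function.update_eq_self, hp] at hc1
        have hpos : 0 ≤ τ * vd f * vd f' := by
          have e3 : τ * vd f * vd f' = c ^ 2 * (τ * ∏ q ∈ univ.erase p,
              (((j : ℕ) : ℝ) - (f q : ℕ)) * (((i : ℕ) : ℝ) - (f q : ℕ))) := by
            rw [hf', hc1, hc2, Finset.prod_mul_distrib]; ring
          rw [e3]
          refine mul_nonneg (sq_nonneg c) ?_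
          rw [← Finset.prod_filter_mul_prod_filter_not (univ.erase p) (fun q => f q ∈ C)]
          have e4 : ∏ q ∈ (univ.erase p).filter (fun q => f q ∈ C),
              (((j : ℕ) : ℝ) - (f q : ℕ)) * (((i : ℕ) : ℝ) - (f q : ℕ)) = τ := by
            rw [hτ]
            refine Finset.prod_bij (fun q _ => f q) ?_ ?_ ?_ ?_
            · intro q hq; exact (Finset.mem_filter.1 hq).2
            · intro a _ b _ hab; exact hf.injective hab
            · intro k hk
              obtain ⟨q, hq⟩ := dt_hit hD (hC k hk).2.2
              have hqp : q ≠ p := by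
                rintro rfl
                rw [hf', Function.update_self] at hq
                have := (hC k hk).1
                rw [hq] at this; exact lt_irrefl _ this
              rw [hf', Function.update_of_ne hqp] at hq
              exact ⟨q, by simp [hqp, hq, hk], hq⟩
            · intros; rfl
          rw [e4, ← mul_assoc]
          refine mul_nonneg (mul_self_nonneg τ) (Finset.prod_nonneg fun q hq => ?_)
          simp only [Finset.mem_filter, Finset.mem_erase, Finset.mem_univ, and_true] at hq
          have hfq : f' q = f q := by rw [hf', Function.update_of_ne hq.1]
          have hqi : f q ≠ i := by
            intro h
            apply hq.1
            apply hinj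
            rw [hfq, h, hf', Function.update_self]
          have hqj : f q ≠ j := fun h => hq.1 (hf.injective (h.trans hp.symm))
          have hbt : ¬ (i < f q ∧ f q < j) := by
            rintro ⟨h1, h2⟩
            have := dt_nonzero hD q
            rw [hfq] at this
            exact this (hL _ h1 h2 hq.2)
          rcases lt_or_gt_of_ne hqi with h1 | h1
          · have h2 : ((f q : ℕ) : ℝ) < (i : ℕ) := by exact_mod_cast h1
            have h3 : ((i : ℕ) : ℝ) < (j : ℕ) := by exact_mod_cast hij
            exact mul_nonneg (by linarith) (by linarith)
          · have h4 : j < f q := lt_of_le_of_ne (not_lt.1 fun h => hbt ⟨h1, h⟩) hqj.symm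
            have h2 : ((j : ℕ) : ℝ) < (f q : ℕ) := by exact_mod_cast h4
            have h3 : ((i : ℕ) : ℝ) < (j : ℕ) := by exact_mod_cast hij
            exact mul_nonneg_of_nonpos_of_nonpos (by linarith) (by linarith)
        have h1 := mul_nonneg hpos (nonneg_all hA f')
        have h2 : 0 < vd f' ^ 2 := by positivity
        have h3 : 0 ≤ (τ * dt A f' * vd f) * vd f' ^ 2 := by nlinarith
        exact nonneg_of_mul_nonneg_left h3 h2
    · push Not at hp
      have : dt A' f = dt A f := by
        unfold dt
        congr 1
        ext r q
        simp [hA', hp q]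
      rw [this]; exact nonneg_all hA f

lemma Spec.coloop [NeZero n] {v : Fin n → Fin d → ℝ} {g : ℕ → ℕ} (h : Spec v g) {k : ℕ}
    (hk : g k = k + n) : v (ix n k) ∉ Submodule.span ℝ (v '' {ix n k}ᶜ) := by
  rcases h.fixed (Or.inr hk) with h0 | h0
  · have := (h.2 k k le_rfl).1 (by rw [h0]; exact Submodule.zero_mem _)
    have := NeZero.pos n
    omega
  · exact h0

lemma Spec.loop [NeZero n] {v : Fin n → Fin d → ℝ} {g : ℕ → ℕ} (h : Spec v g) {k : ℕ}
    (hk : g k = k) : v (ix n k) = 0 := by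
  have := (h.2 k k le_rfl).2 (by omega)
  rwa [arc_self, Set.image_empty, Submodule.span_empty, Submodule.mem_bot] at this

theorem realize [NeZero n] (g : ℕ → ℕ) (h : Bd n g) :
    ∃ (d : ℕ) (A : Matrix (Fin d) (Fin n) ℝ), A.TotallyNonneg ∧ Spec (cols A) g := by
  classical
  induction hN : ∑ k ∈ Finset.range n, k * g k using Nat.strong_induction_on generalizing g with
  | _ N ih =>
    by_cases hne : ∃ k < n, g k ≠ k ∧ g k ≠ k + n
    · obtain ⟨i, j, hb⟩ := h.bridge hne
      have hij := hb.lt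
      have hj := hb.lt'
      obtain ⟨d, A, hA, hs⟩ := ih _ (by rw [← hN]; exact swap_measure hb) _ (h.swap hb) rfl
      have hvi : (ix n i : ℕ) = i := by rw [ix_val, Nat.mod_eq_of_lt (by omega)]
      have hvj : (ix n j : ℕ) = j := by rw [ix_val, Nat.mod_eq_of_lt (by omega)]
      have hsw : ∀ k : Fin n, ix n i < k → k < ix n j →
          i < k.val ∧ k.val < j ∧ g (sw n i j k) = g k := by
        intro k h1 h2
        rw [Fin.lt_def, hvi] at h1
        rw [Fin.lt_def, hvj] at h2
        refine ⟨h1, h2, ?_⟩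
        rw [sw_other] <;> rw [Nat.mod_eq_of_lt k.2] <;> omega
      set C : Finset (Fin n) := univ.filter (fun k : Fin n => ix n i < k ∧ k < ix n j ∧ g k = k + n)
        with hCdef
      have hC : ∀ k ∈ C, ix n i < k ∧ k < ix n j ∧
          cols A k ∉ Submodule.span ℝ (cols A '' {k}ᶜ) := by
        intro k hk
        obtain ⟨h1, h2, h3⟩ := (Finset.mem_filter.1 hk).2
        have h4 := hs.coloop (k := k) (by rw [(hsw k h1 h2).2.2]; exact h3)
        rw [ix_fin] at h4
        exact ⟨h1, h2, h4⟩
      have hL : ∀ k, ix n i < k → k < ix n j → k ∉ C → cols A k = 0 := by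
        intro k h1 h2 h3
        have h4 := hs.loop (k := k) (by
          obtain ⟨h5, h6, h7⟩ := hsw k h1 h2
          rw [h7]
          rcases hb.fix k h5 h6 with h8 | h8
          · exact h8
          · exact absurd (Finset.mem_filter.2 ⟨mem_univ _, h1, h2, h8⟩) h3)
        rwa [ix_fin] at h4
      have hlt : ix n i < ix n j := by rw [Fin.lt_def, hvi, hvj]; exact hij
      refine ⟨d, _, step_tn hA (ix n i) (ix n j) hlt C hC hL, ?_⟩
      set τ := ∏ k ∈ C, (((ix n j : ℕ) : ℝ) - (k : ℕ)) * (((ix n i : ℕ) : ℝ) - (k : ℕ)) with hτ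
      have hτ0 : τ ≠ 0 := by
        rw [hτ, Finset.prod_ne_zero_iff]
        intro k hk
        obtain ⟨h1, h2, -⟩ := hC k hk
        have h3 : ((ix n i : ℕ) : ℝ) < (k : ℕ) := by exact_mod_cast h1
        have h4 : ((k : ℕ) : ℝ) < (ix n j : ℕ) := by exact_mod_cast h2
        exact mul_ne_zero (by linarith) (by linarith)
      have hcol : cols (A.updateCol (ix n j) (cols A (ix n j) + τ • cols A (ix n i))) =
          Function.update (cols A) (ix n j) (cols A (ix n j) + τ • cols A (ix n i)) := by
        funext x r
        by_cases hx : x = ix n j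
        · subst hx; simp [cols]
        · simp [cols, hx]
      rw [hcol]
      exact step_spec h hb hs τ hτ0
    · push Not at hne
      exact base_real h (fun k hk => or_iff_not_imp_left.2 (hne k hk))

end Pos

namespace Pos

variable {d n : ℕ}

/-- Stabilized-interval-free permutations. -/
def SIF {α : Type*} [LinearOrder α] (σ : Equiv.Perm α) : Prop :=
  ∀ s : Set α, s.OrdConnected → s.Nonempty → (∀ x ∈ s, σ x ∈ s) → s = Set.univ

lemma stable_compl {α : Type*} [Finite α] (σ : Equiv.Perm α) {s : Set α} (h : ∀ x ∈ s, σ x ∈ s)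
    {x : α} (hx : x ∉ s) : σ x ∉ s := by
  intro h1
  have h2 := Equiv.Perm.perm_symm_mapsTo_of_mapsTo σ (s := s) h
  have := h2 h1
  simp at this
  exact hx this

lemma mem_arc_lin [NeZero n] {a b : ℕ} (hb : b < n) (x : Fin n) :
    x ∈ arc n a b ↔ a < x.val ∧ x.val ≤ b := by
  constructor
  · rintro ⟨k, h1, h2, rfl⟩
    rw [ix_val, Nat.mod_eq_of_lt (by omega)]; exact ⟨h1, h2⟩
  · rintro ⟨h1, h2⟩
    exact ⟨x, h1, h2, ix_fin x⟩

lemma arc_lin_not_sif [NeZero n] {a b : ℕ} (hab : a < b) (hb : b < n) (σ : Equiv.Perm (Fin n))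
    (h : ∀ x ∈ arc n a b, σ x ∈ arc n a b) : ¬ SIF σ := by
  intro hs
  have h1 : (arc n a b).OrdConnected := by
    refine ⟨fun x hx y hy z hz => ?_⟩
    rw [mem_arc_lin hb] at *
    have h2 := hz.1
    have h3 := hz.2
    rw [Fin.le_def] at h2 h3
    omega
  have h2 := hs _ h1 ⟨ix n b, b, hab, le_rfl, rfl⟩ h
  have h3 : (⟨a, by omega⟩ : Fin n) ∈ arc n a b := by rw [h2]; trivial
  rw [mem_arc_lin hb] at h3
  simp at h3

lemma arc_not_sif [NeZero n] {i j : ℕ} (hij : i < j) (hj : j < i + n) (σ : Equiv.Perm (Fin n))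
    (h : ∀ x ∈ arc n i j, σ x ∈ arc n i j) : ¬ SIF σ := by
  obtain ⟨q, hq⟩ := mod_form (n := n) (k := i) rfl
  have hn := Nat.mod_lt i (NeZero.pos n)
  set a := i % n
  have e1 : arc n i j = arc n a (j - q * n) := by
    rw [← arc_shift a _ q]; congr 1; omega
  by_cases hb : j - q * n < n
  · rw [e1] at h
    exact arc_lin_not_sif (by omega) hb σ h
  · have h' : ∀ x ∈ (arc n i j)ᶜ, σ x ∈ (arc n i j)ᶜ := fun x hx => stable_compl σ h hx
    have e2 : (arc n i j)ᶜ = arc n (j - q * n - n) a := by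
      rw [e1, arc_compl (by omega) (by omega), ← arc_shift _ a 1]
      congr 1 <;> omega
    rw [e2] at h'
    exact arc_lin_not_sif (by omega) hn σ h'

lemma ord_arc [NeZero n] {s : Set (Fin n)} (h1 : s.OrdConnected) (h2 : s.Nonempty)
    (h3 : s ≠ Set.univ) : ∃ i j, i < j ∧ j < i + n ∧ s = arc n i j := by
  obtain ⟨a, ha, hamin⟩ := s.exists_min_image id s.toFinite h2
  obtain ⟨b, hb, hbmax⟩ := s.exists_max_image id s.toFinite h2
  have hab : a ≤ b := hamin b hb
  have hs : s = Set.Icc a b := by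
    apply Set.Subset.antisymm
    · intro x hx; exact ⟨hamin x hx, hbmax x hx⟩
    · exact h1.out ha hb
  have hab' : a.val ≤ b.val := hab
  have ha2 := a.2
  have hb2 := b.2
  have hne : ¬ (a.val = 0 ∧ b.val = n - 1) := by
    rintro ⟨h4, h5⟩
    apply h3
    rw [hs]; ext x
    have := x.2
    simp only [Set.mem_Icc, Fin.le_def, Set.mem_univ, iff_true]
    omega
  refine ⟨a + n - 1, b + n, by omega, by omega, ?_⟩
  rw [hs]; ext x
  simp only [Set.mem_Icc, Fin.le_def]
  constructor
  · rintro ⟨h4, h5⟩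
    exact ⟨x + n, by omega, by omega, by rw [ix_add_one, ix_fin]⟩
  · rintro ⟨k, h4, h5, rfl⟩
    have : k = k - n + 1 * n := by omega
    rw [ix_val, this, form_mod (by omega)]
    omega

/-- The affine lift of a permutation. -/
def fl [NeZero n] (σ : Equiv.Perm (Fin n)) (k : ℕ) : ℕ := k + ((σ (ix n k)).val + n - k % n) % n

lemma ix_fl [NeZero n] (σ : Equiv.Perm (Fin n)) (k : ℕ) : ix n (fl σ k) = σ (ix n k) := by
  have hn := Nat.mod_lt k (NeZero.pos n)
  apply Fin.ext
  rw [ix_val, fl]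
  have h1 := (σ (ix n k)).2
  rw [Nat.add_mod_mod]
  generalize (σ (ix n k)).val = s at h1 ⊢
  have h2 := Nat.mod_add_div k n
  have h3 : k + (s + n - k % n) = s + (k / n + 1) * n := by
    rw [add_mul, Nat.mul_comm (k / n)]; omega
  rw [h3]
  exact form_mod h1

lemma fl_bd [NeZero n] (σ : Equiv.Perm (Fin n)) : Bd n (fl σ) := by
  refine ⟨fun k => by unfold fl; omega, fun k => ?_, fun k => ?_, fun a b hab => ?_⟩
  · have := Nat.mod_lt ((σ (ix n k)).val + n - k % n) (NeZero.pos n)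
    unfold fl; omega
  · unfold fl; rw [ix_add_one, Nat.add_mod_right]; omega
  · have h1 : σ (ix n a) = σ (ix n b) := by rw [← ix_fl, ← ix_fl, hab]
    have h2 := σ.injective h1
    have h3 := (ix_eq_iff _ _).1 h2
    unfold fl at hab
    rw [h2, h3] at hab
    omega

lemma fl_unique [NeZero n] {g : ℕ → ℕ} (h : Bd n g) (σ : Equiv.Perm (Fin n))
    (h1 : ∀ k, ix n (g k) = σ (ix n k)) (h2 : ∀ k, g k ≠ k + n) : g = fl σ := by
  funext k
  have h3 : ix n (g k) = ix n (fl σ k) := by rw [h1, ix_fl]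
  have h4 := h.ge k
  have h5 := h.le k
  have h6 := h2 k
  have h7 := (fl_bd σ).ge k
  have h8 : fl σ k < k + n := by
    have := Nat.mod_lt ((σ (ix n k)).val + n - k % n) (NeZero.pos n)
    unfold fl; omega
  rcases le_total (g k) (fl σ k) with hl | hl
  · exact ix_inj h3 hl (by omega)
  · exact (ix_inj h3.symm hl (by omega)).symm

lemma Bd.perm [NeZero n] {g : ℕ → ℕ} (h : Bd n g) :
    ∃ σ : Equiv.Perm (Fin n), ∀ k, ix n (g k) = σ (ix n k) := by
  have hinj : Function.Injective (fun x : Fin n => ix n (g x)) := by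
    intro x y hxy
    have := h.ix_inj hxy
    rwa [ix_fin, ix_fin] at this
  refine ⟨Equiv.ofBijective _ (Finite.injective_iff_bijective.1 hinj), fun k => ?_⟩
  obtain ⟨q, hq⟩ := mod_form (n := n) (k := k) rfl
  rw [Equiv.ofBijective_apply, ix_val]
  conv_lhs => rw [hq, h.per_mul, ix_add]

/-- The correspondence between positroids and permutations. -/
def Rel [NeZero n] (B : Finset (Finset (Fin n))) (σ : Equiv.Perm (Fin n)) : Prop :=
  ∃ (d : ℕ) (A : Matrix (Fin d) (Fin n) ℝ), A.TotallyNonneg ∧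
    A.RepresentsBases (fun X => X ∈ B) ∧ Spec (cols A) (fl σ)

lemma Rel.unique [NeZero n] {B B' : Finset (Finset (Fin n))} {σ : Equiv.Perm (Fin n)}
    (h : Rel B σ) (h' : Rel B' σ) : B = B' := by
  obtain ⟨d, A, h1, h2, h3⟩ := h
  obtain ⟨d', A', h1', h2', h3'⟩ := h'
  ext X
  have e1 := reps_iff h2 X
  have e2 := reps_iff h2' X
  rw [e1, e2, spec_basis_iff h1 h3, spec_basis_iff h1' h3']

lemma Rel.inj [NeZero n] {B : Finset (Finset (Fin n))} {σ σ' : Equiv.Perm (Fin n)}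
    (h : Rel B σ) (h' : Rel B σ') : σ = σ' := by
  obtain ⟨d, A, h1, h2, h3⟩ := h
  obtain ⟨d', A', h1', h2', h3'⟩ := h'
  have h4 := (h3.of_reps h1.1 h1'.1 h2 h2').ext h3'
  ext x
  have : ix n (fl σ x) = ix n (fl σ' x) := by rw [h4]
  rw [ix_fl, ix_fl, ix_fin] at this
  rw [this]

lemma Rel.conn [NeZero n] {B : Finset (Finset (Fin n))} {σ : Equiv.Perm (Fin n)}
    (h : Rel B σ) (hσ : SIF σ) : MatroidConnected (fun X => X ∈ B) := by
  obtain ⟨d, A, h1, h2, h3⟩ := h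
  rw [conn_iff_spec h1 h2 h3]
  rintro ⟨i, j, h4, h5, h6⟩
  refine arc_not_sif h4 h5 σ ?_ hσ
  rintro _ ⟨k, h7, h8, rfl⟩
  rw [← ix_fl]; exact h6 k h7 h8

lemma exists_rel [NeZero n] (σ : Equiv.Perm (Fin n)) : ∃ B, Rel B σ := by
  classical
  obtain ⟨d, A, h1, h2⟩ := realize (fl σ) (fl_bd σ)
  refine ⟨univ.filter (fun B => B.card = d ∧ LinearIndependent ℝ (fun j : B => fun i => A i j.1)),
    d, A, h1, ?_, h2⟩
  intro B
  simp

lemma exists_sif [NeZero n] (hn : 2 ≤ n) {B : Finset (Finset (Fin n))}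
    (h1 : IsPositroid (fun X => X ∈ B)) (h2 : MatroidConnected (fun X => X ∈ B)) :
    ∃ σ, SIF σ ∧ Rel B σ := by
  obtain ⟨d, A, h3, h4⟩ := h1
  obtain ⟨g, hg⟩ := exists_spec (cols A)
  rw [conn_iff_spec h3 h4 hg] at h2
  obtain ⟨σ, hσ⟩ := hg.bd.perm
  have hS : SIF σ := by
    intro s hs1 hs2 hs3
    by_contra hne
    obtain ⟨i, j, h5, h6, rfl⟩ := ord_arc hs1 hs2 hne
    exact h2 ⟨i, j, h5, h6, fun k h7 h8 => by rw [hσ]; exact hs3 _ ⟨k, h7, h8, rfl⟩⟩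
  refine ⟨σ, hS, d, A, h3, h4, ?_⟩
  rw [← fl_unique hg.bd σ hσ]
  · exact hg
  · intro k hk
    have h5 := hS {ix n k} Set.ordConnected_singleton ⟨_, rfl⟩ (by
      intro x hx
      rw [Set.mem_singleton_iff] at hx ⊢
      rw [hx, ← hσ, hk, ix_add_one])
    have h6 : ix n (k + 1) ∈ ({ix n k} : Set (Fin n)) := by rw [h5]; trivial
    have := ix_inj (Set.mem_singleton_iff.1 h6).symm (by omega) (by omega)
    omega

/-- The number of stabilized-interval-free permutations of a linear order. -/
noncomputable def sif (α : Type*) [LinearOrder α] : ℕ := Nat.card {σ : Equiv.Perm α // SIF σ}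

theorem numConn_eq_sif (hn : 2 ≤ n) : numConnPositroids n = sif (Fin n) := by
  haveI : NeZero n := ⟨by omega⟩
  choose F hF using fun σ : Equiv.Perm (Fin n) => exists_rel σ
  unfold numConnPositroids sif
  refine (Nat.card_congr (Equiv.ofBijective
    (fun σ : {σ : Equiv.Perm (Fin n) // SIF σ} => (⟨F σ.1, ?_, (hF σ.1).conn σ.2⟩ :
      {ℬ : Finset (Finset (Fin n)) //
        IsPositroid (fun B => B ∈ ℬ) ∧ MatroidConnected (fun B => B ∈ ℬ)})) ⟨?_, ?_⟩)).symm
  · obtain ⟨d, A, h1, h2, h3⟩ := hF σ.1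
    exact ⟨d, A, h1, h2⟩
  · intro σ τ h
    have h1 : F σ.1 = F τ.1 := congrArg Subtype.val h
    have h2 := hF σ.1
    rw [h1] at h2
    exact Subtype.ext (h2.inj (hF τ.1))
  · rintro ⟨B, h1, h2⟩
    obtain ⟨σ, h3, h4⟩ := exists_sif hn h1 h2
    exact ⟨⟨σ, h3⟩, Subtype.ext ((hF σ).unique h4)⟩

end Pos

namespace Pos

lemma sif_congr {α β : Type*} [LinearOrder α] [LinearOrder β] (e : α ≃o β) : sif α = sif β := by
  unfold sif
  refine Nat.card_congr (Equiv.subtypeEquiv e.toEquiv.permCongr fun σ => ?_)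
  constructor
  · intro h s h1 h2 h3
    have h4 := h (e ⁻¹' s) ?_ ?_ ?_
    · rw [Set.eq_univ_iff_forall] at h4 ⊢
      intro x
      have := h4 (e.symm x)
      simpa using this
    · exact h1.preimage_mono e.monotone
    · obtain ⟨x, hx⟩ := h2
      exact ⟨e.symm x, by simpa using hx⟩
    · intro x hx
      have := h3 (e x) hx
      simpa [Equiv.permCongr_apply] using this
  · intro h s h1 h2 h3
    have h4 := h (e.symm ⁻¹' s) ?_ ?_ ?_
    · rw [Set.eq_univ_iff_forall] at h4 ⊢
      intro x
      have := h4 (e x)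
      simpa using this
    · exact h1.preimage_mono e.symm.monotone
    · obtain ⟨x, hx⟩ := h2
      exact ⟨e x, by simpa using hx⟩
    · intro x hx
      have := h3 (e.symm x) hx
      simpa [Equiv.permCongr_apply] using this

lemma sif_fin {α : Type*} [LinearOrder α] [Fintype α] {m : ℕ} (h : Fintype.card α = m) :
    sif α = sif (Fin m) := sif_congr (Fintype.orderIsoFinOfCardEq α h).symm

/-- Pointed permutations all of whose stabilized intervals contain the point. -/
def GP {α : Type*} [LinearOrder α] (i : α) (τ : Equiv.Perm α) : Prop :=
  ∀ s : Set α, s.OrdConnected → s.Nonempty → (∀ x ∈ s, τ x ∈ s) → i ∈ s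

/-- The number of such pointed permutations. -/
noncomputable def gp (α : Type*) [LinearOrder α] : ℕ :=
  Nat.card {p : α × Equiv.Perm α // GP p.1 p.2}

lemma insert_apply {α : Type*} [DecidableEq α] (i : α) (τ : Equiv.Perm α) (x : α) :
    Equiv.Perm.decomposeOption.symm (some i, τ) (some x) =
      if τ x = i then none else some (τ x) := by
  simp only [Equiv.Perm.decomposeOption_symm_apply, Equiv.Perm.mul_apply,
    Equiv.optionCongr_apply, Option.map_some]
  split_ifs with h
  · rw [h, Equiv.swap_apply_right]
  · rw [Equiv.swap_apply_of_ne_of_ne (by simp) (by simpa using h)]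

lemma insert_none {α : Type*} [DecidableEq α] (i : α) (τ : Equiv.Perm α) :
    Equiv.Perm.decomposeOption.symm (some i, τ) none = some i := by
  simp

lemma sif_insert {α : Type*} [LinearOrder α] [Finite α] (i : α) (τ : Equiv.Perm α) :
    SIF (α := WithTop α) (Equiv.Perm.decomposeOption.symm (some i, τ)) ↔ GP i τ := by
  constructor
  · intro h s h1 h2 h3
    by_contra hi
    have h4 := h ((fun x : α => (x : WithTop α)) '' s) ?_ (h2.image _) ?_
    · have : (⊤ : WithTop α) ∈ ((fun x : α => (x : WithTop α)) '' s) := by rw [h4]; trivial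
      obtain ⟨x, hx, h5⟩ := this
      exact WithTop.coe_ne_top h5
    · refine ⟨?_⟩
      rintro _ ⟨x, hx, rfl⟩ _ ⟨y, hy, rfl⟩ z ⟨hz1, hz2⟩
      have hz : z ≠ ⊤ := by
        rintro rfl
        simp at hz2
      lift z to α using hz
      exact ⟨z, h1.out hx hy ⟨WithTop.coe_le_coe.1 hz1, WithTop.coe_le_coe.1 hz2⟩, rfl⟩
    · rintro _ ⟨x, hx, rfl⟩
      have h5 := insert_apply i τ x
      rw [if_neg] at h5
      · refine ⟨τ x, h3 x hx, h5.symm⟩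
      · rintro h6
        exact hi (h6 ▸ h3 x hx)
  · intro h s h1 h2 h3
    have key : ∀ t : Set (WithTop α), t.OrdConnected → t.Nonempty →
        (∀ x ∈ t, (Equiv.Perm.decomposeOption.symm (some i, τ) : Equiv.Perm (Option α)) x ∈ t) →
        (⊤ : WithTop α) ∈ t := by
      intro t h4 h5 h6
      by_contra h7
      have h8 := h {x | (x : WithTop α) ∈ t} ?_ ?_ ?_
      · have h9 : τ (τ.symm i) = i := by simp
        have h10 : ∀ x : α, (x : WithTop α) ∈ t → τ x ≠ i := by
          intro x hx h11
          have := h6 x hx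
          have h12 := insert_apply i τ x
          rw [if_pos h11] at h12
          erw [h12] at this
          exact h7 this
        have h13 := stable_compl τ (s := {x : α | (x : WithTop α) ∈ t}) (x := τ.symm i) ?_ ?_
        · rw [h9] at h13; exact h13 h8
        · intro x hx
          have := h6 x hx
          have h12 := insert_apply i τ x
          rw [if_neg (h10 x hx)] at h12
          erw [h12] at this
          exact this
        · intro hx
          exact h10 _ hx h9
      · exact ⟨fun x hx y hy z hz => h4.out hx hy
          ⟨WithTop.coe_le_coe.2 hz.1, WithTop.coe_le_coe.2 hz.2⟩⟩
      · obtain ⟨x, hx⟩ := h5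
        have hx' : x ≠ ⊤ := fun hh => h7 (hh ▸ hx)
        lift x to α using hx'
        exact ⟨x, hx⟩
      · intro x hx
        have := h6 x hx
        have h12 := insert_apply i τ x
        split_ifs at h12 with h13
        · erw [h12] at this
          exact absurd this h7
        · erw [h12] at this
          exact this
    by_contra hne
    have h4 := key s h1 h2 h3
    have h5 : (sᶜ).Nonempty := by
      rwa [Set.nonempty_compl]
    have h6 := key sᶜ ?_ h5 ?_
    · exact h6 h4
    · exact ⟨fun x hx y hy z hz hzs => hy (h1.out hzs h4 ⟨hz.2, le_top⟩)⟩
    · intro x hx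
      exact stable_compl (α := Option α) _ h3 hx

lemma gp_eq {α : Type*} [LinearOrder α] [Finite α] [Nonempty α] :
    gp α = sif (WithTop α) := by
  unfold gp sif
  refine Nat.card_congr (Equiv.ofBijective
    (fun p : {p : α × Equiv.Perm α // GP p.1 p.2} =>
      (⟨Equiv.Perm.decomposeOption.symm (some p.1.1, p.1.2), (sif_insert _ _).2 p.2⟩ :
        {σ : Equiv.Perm (WithTop α) // SIF σ})) ⟨?_, ?_⟩)
  · intro p q h
    have h1 := congrArg Subtype.val h
    have h2 := Equiv.Perm.decomposeOption.symm.injective h1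
    rw [Prod.mk.injEq, Option.some.injEq] at h2
    exact Subtype.ext (Prod.ext h2.1 h2.2)
  · rintro ⟨σ, hσ⟩
    obtain ⟨⟨o, τ⟩, h⟩ := Equiv.Perm.decomposeOption.symm.surjective (σ : Equiv.Perm (Option α))
    cases o with
    | none =>
      exfalso
      have h1 : σ ⊤ = ⊤ := by
        rw [← h]
        exact Equiv.Perm.decomposeOption_symm_of_none_apply τ none
      have h2 := hσ {⊤} Set.ordConnected_singleton ⟨_, rfl⟩ (by
        rintro x rfl; exact h1)
      obtain ⟨x⟩ := ‹Nonempty α›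
      have h3 : (x : WithTop α) ∈ ({⊤} : Set (WithTop α)) := by rw [h2]; trivial
      exact WithTop.coe_ne_top h3
    | some i =>
      subst h
      exact ⟨⟨(i, τ), (sif_insert i τ).1 hσ⟩, rfl⟩

end Pos

namespace Pos

variable {α : Type*} [LinearOrder α] [BoundedOrder α] [Finite α]

/-- Interior intervals. -/
def Mid (K : Set α) : Prop := K.OrdConnected ∧ K.Nonempty ∧ ⊥ ∉ K ∧ ⊤ ∉ K

open Classical in
/-- Glue two permutations. -/
noncomputable def glue (K : Set α) (ρ : Equiv.Perm {x // x ∈ K}) (π : Equiv.Perm {x // x ∉ K}) :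
    Equiv.Perm α := Equiv.Perm.subtypeCongr ρ π

lemma glue_mem {K : Set α} (ρ : Equiv.Perm {x // x ∈ K}) (π : Equiv.Perm {x // x ∉ K})
    (x : {x // x ∈ K}) : glue K ρ π x = ρ x := by
  classical
  unfold glue
  exact Equiv.Perm.subtypeCongr.left_apply_subtype ρ π x

lemma glue_not_mem {K : Set α} (ρ : Equiv.Perm {x // x ∈ K}) (π : Equiv.Perm {x // x ∉ K})
    (x : {x // x ∉ K}) : glue K ρ π x = π x := by
  classical
  unfold glue
  exact Equiv.Perm.subtypeCongr.right_apply_subtype ρ π x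

lemma glue_inj {K : Set α} {ρ ρ' : Equiv.Perm {x // x ∈ K}} {π π' : Equiv.Perm {x // x ∉ K}}
    (h : glue K ρ π = glue K ρ' π') : ρ = ρ' ∧ π = π' := by
  constructor
  · ext x
    rw [← glue_mem ρ π, h, glue_mem]
  · ext x
    rw [← glue_not_mem ρ π, h, glue_not_mem]

lemma glue_stable {K : Set α} (ρ : Equiv.Perm {x // x ∈ K}) (π : Equiv.Perm {x // x ∉ K}) :
    ∀ x ∈ K, glue K ρ π x ∈ K := by
  intro x hx
  rw [glue_mem ρ π ⟨x, hx⟩]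
  exact (ρ ⟨x, hx⟩).2

lemma glue_gp {K : Set α} (hK : Mid K) {i : {x // x ∈ K}} {ρ : Equiv.Perm {x // x ∈ K}}
    {π : Equiv.Perm {x // x ∉ K}} (h1 : GP i ρ) (h2 : SIF π) : GP i.1 (glue K ρ π) := by
  intro s hs1 hs2 hs3
  by_cases hsK : ∃ x ∈ s, x ∈ K
  · obtain ⟨x, hx1, hx2⟩ := hsK
    have := h1 (Subtype.val ⁻¹' s) (hs1.preimage_mono (Subtype.mono_coe _)) ⟨⟨x, hx2⟩, hx1⟩ (by
      intro y hy
      have := hs3 y hy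
      rwa [glue_mem] at this)
    exact this
  · exfalso
    push Not at hsK
    have h3 := h2 (Subtype.val ⁻¹' s) (hs1.preimage_mono (Subtype.mono_coe _)) (by
        obtain ⟨x, hx⟩ := hs2
        exact ⟨⟨x, hsK x hx⟩, hx⟩) (by
      intro y hy
      have := hs3 y hy
      rwa [glue_not_mem] at this)
    have h4 : (⟨⊥, hK.2.2.1⟩ : {x // x ∉ K}) ∈ Subtype.val ⁻¹' s := by rw [h3]; trivial
    have h5 : (⟨⊤, hK.2.2.2⟩ : {x // x ∉ K}) ∈ Subtype.val ⁻¹' s := by rw [h3]; trivial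
    exact hsK _ (hs1.out h4 h5 ⟨bot_le, le_top⟩) i.2

lemma glue_max {K : Set α} {ρ : Equiv.Perm {x // x ∈ K}}
    {π : Equiv.Perm {x // x ∉ K}} (hK : ⊥ ∉ K) (h2 : SIF π) {s : Set α}
    (hs : ∀ x ∈ s, glue K ρ π x ∈ s) (hs1 : s.OrdConnected) (hb : ⊥ ∉ s) : s ⊆ K := by
  by_contra hne
  rw [Set.not_subset] at hne
  obtain ⟨x, hx1, hx2⟩ := hne
  have h3 := h2 (Subtype.val ⁻¹' s) (hs1.preimage_mono (Subtype.mono_coe _)) ⟨⟨x, hx2⟩, hx1⟩ (by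
      intro y hy
      have := hs y hy
      rwa [glue_not_mem] at this)
  have h4 : (⟨⊥, hK⟩ : {x // x ∉ K}) ∈ Subtype.val ⁻¹' s := by rw [h3]; trivial
  exact hb h4

lemma gp_proper {i : α} {τ : Equiv.Perm α} (h : GP i τ) {s : Set α} (h1 : s.OrdConnected)
    (h2 : s.Nonempty) (h3 : ∀ x ∈ s, τ x ∈ s) (h4 : s ≠ Set.univ) : ⊥ ∉ s ∧ ⊤ ∉ s := by
  have hi := h s h1 h2 h3
  have h5 : (sᶜ).Nonempty := by rwa [Set.nonempty_compl]
  have h6 : ¬ (sᶜ).OrdConnected := fun hc =>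
    h sᶜ hc h5 (fun x hx => stable_compl τ h3 hx) hi
  constructor
  · intro hb
    exact h6 ⟨fun x hx y hy z hz hzs => hx (h1.out hb hzs ⟨bot_le, hz.1⟩)⟩
  · intro hb
    exact h6 ⟨fun x hx y hy z hz hzs => hy (h1.out hzs hb ⟨hz.2, le_top⟩)⟩

lemma gp_decomp {i : α} {τ : Equiv.Perm α} (h : GP i τ) (hn : ¬ SIF τ) :
    ∃ (K : Set α) (hi : i ∈ K) (ρ : Equiv.Perm {x // x ∈ K}) (π : Equiv.Perm {x // x ∉ K}),
      Mid K ∧ GP ⟨i, hi⟩ ρ ∧ SIF π ∧ glue K ρ π = τ := by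
  unfold SIF at hn
  push Not at hn
  obtain ⟨s₀, h01, h02, h03, h04⟩ := hn
  set K : Set α := {x | ∃ s : Set α, s.OrdConnected ∧ s.Nonempty ∧ (∀ x ∈ s, τ x ∈ s) ∧
    s ≠ Set.univ ∧ x ∈ s} with hKdef
  have hi : i ∈ K := ⟨s₀, h01, h02, h03, h04, h _ h01 h02 h03⟩
  have hst : ∀ x ∈ K, τ x ∈ K := by
    rintro x ⟨s, h1, h2, h3, h4, h5⟩
    exact ⟨s, h1, h2, h3, h4, h3 x h5⟩
  have hoc : K.OrdConnected := by
    refine ⟨?_⟩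
    rintro x ⟨s, h1, h2, h3, h4, h5⟩ y ⟨s', h1', h2', h3', h4', h5'⟩ z hz
    rcases le_total z i with hzi | hzi
    · exact ⟨s, h1, h2, h3, h4, h1.out h5 (h s h1 h2 h3) ⟨hz.1, hzi⟩⟩
    · exact ⟨s', h1', h2', h3', h4', h1'.out (h s' h1' h2' h3') h5' ⟨hzi, hz.2⟩⟩
  have hbot : ⊥ ∉ K := by
    rintro ⟨s, h1, h2, h3, h4, h5⟩
    exact (gp_proper h h1 h2 h3 h4).1 h5
  have htop : ⊤ ∉ K := by
    rintro ⟨s, h1, h2, h3, h4, h5⟩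
    exact (gp_proper h h1 h2 h3 h4).2 h5
  have hiff : ∀ x, τ x ∈ K ↔ x ∈ K := fun x =>
    ⟨fun hx => by by_contra hc; exact stable_compl τ hst hc hx, hst x⟩
  refine ⟨K, hi, τ.subtypePerm hiff, τ.subtypePerm (fun x => not_congr (hiff x)),
    ⟨hoc, ⟨i, hi⟩, hbot, htop⟩, ?_, ?_, ?_⟩
  · intro s h1 h2 h3
    have := h (Subtype.val '' s) ?_ (h2.image _) ?_
    · obtain ⟨y, hy, h4⟩ := this
      have : y = ⟨i, hi⟩ := Subtype.ext h4
      rwa [← this]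
    · refine ⟨?_⟩
      rintro _ ⟨x, hx, rfl⟩ _ ⟨y, hy, rfl⟩ z hz
      exact ⟨⟨z, hoc.out x.2 y.2 hz⟩, h1.out hx hy hz, rfl⟩
    · rintro _ ⟨x, hx, rfl⟩
      exact ⟨_, h3 x hx, rfl⟩
  · intro t h1 h2 h3
    have hst' : ∀ x ∈ Subtype.val '' t, τ x ∈ Subtype.val '' t := by
      rintro _ ⟨x, hx, rfl⟩
      exact ⟨_, h3 x hx, rfl⟩
    have hno : ¬ (Subtype.val '' t).OrdConnected := by
      intro hc
      obtain ⟨x, hx, h4⟩ := h _ hc (h2.image _) hst'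
      exact x.2 (h4 ▸ hi)
    have hlt : ∃ x ∈ t, x.1 < i := by
      by_contra hc
      push Not at hc
      apply hno
      refine ⟨?_⟩
      rintro _ ⟨x, hx, rfl⟩ _ ⟨y, hy, rfl⟩ z hz
      have hzK : z ∉ K := fun hzK => x.2 (hoc.out hi hzK ⟨hc x hx, hz.1⟩)
      exact ⟨⟨z, hzK⟩, h1.out hx hy hz, rfl⟩
    have hgt : ∃ x ∈ t, i < x.1 := by
      by_contra hc
      push Not at hc
      apply hno
      refine ⟨?_⟩
      rintro _ ⟨x, hx, rfl⟩ _ ⟨y, hy, rfl⟩ z hz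
      have hzK : z ∉ K := fun hzK => y.2 (hoc.out hzK hi ⟨hz.2, hc y hy⟩)
      exact ⟨⟨z, hzK⟩, h1.out hx hy hz, rfl⟩
    obtain ⟨a, ha, hai⟩ := hlt
    obtain ⟨b, hb, hbi⟩ := hgt
    have hU : (K ∪ Subtype.val '' t).OrdConnected := by
      refine ⟨?_⟩
      intro u hu v hv z hz
      by_cases hzK : z ∈ K
      · exact Or.inl hzK
      right
      rcases le_total z i with hzi | hzi
      · rcases hu with hu | ⟨u, hu, rfl⟩
        · exact absurd (hoc.out hu hi ⟨hz.1, hzi⟩) hzK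
        · exact ⟨⟨z, hzK⟩, h1.out hu hb ⟨hz.1, hzi.trans hbi.le⟩, rfl⟩
      · rcases hv with hv | ⟨v, hv, rfl⟩
        · exact absurd (hoc.out hi hv ⟨hzi, hz.2⟩) hzK
        · exact ⟨⟨z, hzK⟩, h1.out ha hv ⟨hai.le.trans hzi, hz.2⟩, rfl⟩
    by_cases hu : K ∪ Subtype.val '' t = Set.univ
    · rw [Set.eq_univ_iff_forall] at hu ⊢
      intro x
      rcases hu x with hx | ⟨y, hy, h4⟩
      · exact absurd hx x.2
      · rwa [← Subtype.ext h4]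
    · exfalso
      apply a.2
      refine ⟨_, hU, ⟨i, Or.inl hi⟩, ?_, hu, Or.inr ⟨a, ha, rfl⟩⟩
      rintro x (hx | hx)
      · exact Or.inl (hst x hx)
      · exact Or.inr (hst' x hx)
  · ext x
    by_cases hx : x ∈ K
    · rw [glue_mem _ _ ⟨x, hx⟩]; rfl
    · rw [glue_not_mem _ _ ⟨x, hx⟩]; rfl

/-- The gluing map. -/
noncomputable def Phi : (α × {σ : Equiv.Perm α // SIF σ}) ⊕
    (Σ K : {K : Set α // Mid K}, {p : {x // x ∈ K.1} × Equiv.Perm {x // x ∈ K.1} // GP p.1 p.2} ×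
      {π : Equiv.Perm {x // x ∉ K.1} // SIF π}) → {p : α × Equiv.Perm α // GP p.1 p.2}
  | Sum.inl p => ⟨(p.1, p.2.1), fun s h1 h2 h3 => by rw [p.2.2 s h1 h2 h3]; trivial⟩
  | Sum.inr q => ⟨(q.2.1.1.1.1, glue q.1.1 q.2.1.1.2 q.2.2.1), glue_gp q.1.2 q.2.1.2 q.2.2.2⟩

lemma glue_not_sif {K : Set α} (hK : Mid K) (ρ : Equiv.Perm {x // x ∈ K})
    (π : Equiv.Perm {x // x ∉ K}) : ¬ SIF (glue K ρ π) := by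
  intro h
  have := h K hK.1 hK.2.1 (glue_stable ρ π)
  apply hK.2.2.1
  rw [this]; trivial

lemma Phi_bij : Function.Bijective (Phi (α := α)) := by
  constructor
  · rintro (⟨i, σ, hσ⟩ | ⟨⟨K, hK⟩, ⟨⟨i, ρ⟩, hρ⟩, π, hπ⟩) (⟨i', σ', hσ'⟩ |
      ⟨⟨K', hK'⟩, ⟨⟨i', ρ'⟩, hρ'⟩, π', hπ'⟩) h
    · have h1 := congrArg Subtype.val h
      simp only [Phi, Prod.mk.injEq] at h1
      obtain ⟨rfl, rfl⟩ := h1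
      rfl
    · have h1 := congrArg Subtype.val h
      simp only [Phi, Prod.mk.injEq] at h1
      exact absurd (h1.2 ▸ hσ) (glue_not_sif hK' _ _)
    · have h1 := congrArg Subtype.val h
      simp only [Phi, Prod.mk.injEq] at h1
      exact absurd (h1.2 ▸ hσ') (glue_not_sif hK _ _)
    · have h1 := congrArg Subtype.val h
      simp only [Phi, Prod.mk.injEq] at h1
      have hKK : K = K' := by
        apply Set.Subset.antisymm
        · exact glue_max hK'.2.2.1 hπ' (ρ := ρ') (by rw [← h1.2]; exact glue_stable ρ π)
            hK.1 hK.2.2.1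
        · exact glue_max hK.2.2.1 hπ (ρ := ρ) (by rw [h1.2]; exact glue_stable ρ' π')
            hK'.1 hK'.2.2.1
      subst hKK
      obtain ⟨h2, h3⟩ := h1
      obtain ⟨rfl, rfl⟩ := glue_inj h3
      obtain rfl := Subtype.ext h2
      rfl
  · rintro ⟨⟨i, τ⟩, h⟩
    by_cases hs : SIF τ
    · exact ⟨Sum.inl (i, ⟨τ, hs⟩), rfl⟩
    · obtain ⟨K, hi, ρ, π, h1, h2, h3, h4⟩ := gp_decomp h hs
      refine ⟨Sum.inr ⟨⟨K, h1⟩, ⟨(⟨i, hi⟩, ρ), h2⟩, ⟨π, h3⟩⟩, ?_⟩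
      apply Subtype.ext
      simp only [Phi, Prod.mk.injEq]
      exact ⟨trivial, h4⟩

open Classical in
lemma gp_rec [Fintype α] : gp α = Fintype.card α * sif α +
    ∑ K : {K : Set α // Mid K}, gp {x // x ∈ K.1} * sif {x // x ∉ K.1} := by
  have h := Nat.card_eq_of_bijective _ (Phi_bij (α := α))
  unfold gp
  rw [← h, Nat.card_sum, Nat.card_prod, Nat.card_sigma, Nat.card_eq_fintype_card (α := α)]
  congr 1
  apply Finset.sum_congr rfl
  intro K _
  rw [Nat.card_prod]
  rfl

end Pos

namespace Pos

variable {n : ℕ}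

/-- The interval of length `k` starting at `x`. -/
def II (n x k : ℕ) : Set (Fin n) := {z | x ≤ z.val ∧ z.val < x + k}

lemma II_ord (x k : ℕ) : (II n x k).OrdConnected := by
  refine ⟨fun a ha b hb z hz => ?_⟩
  have h1 := Fin.le_def.1 hz.1
  have h2 := Fin.le_def.1 hz.2
  exact ⟨by have := ha.1; omega, by have := hb.2; omega⟩

lemma II_card {x k : ℕ} (h : x + k ≤ n) : Nat.card {z // z ∈ II n x k} = k := by
  have e : Fin k ≃ {z // z ∈ II n x k} :=
    { toFun := fun i => ⟨⟨x + i, by have := i.2; omega⟩, by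
        have := i.2
        exact ⟨by simp, by simp⟩⟩
      invFun := fun z => ⟨z.1.val - x, by
        have h1 := z.2.1
        have h2 := z.2.2
        omega⟩
      left_inv := fun i => by
        apply Fin.ext
        simp
      right_inv := fun z => by
        apply Subtype.ext
        apply Fin.ext
        have h1 := z.2.1
        simp only
        omega }
  rw [← Nat.card_congr e, Nat.card_eq_fintype_card, Fintype.card_fin]

lemma card_compl_sub (s : Set (Fin n)) :
    Nat.card {z // z ∉ s} = n - Nat.card {z // z ∈ s} := by
  classical
  rw [Nat.card_eq_fintype_card, Nat.card_eq_fintype_card, Fintype.card_subtype_compl,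
    Fintype.card_fin]

lemma exists_II {s : Set (Fin n)} (h1 : s.OrdConnected) (h2 : s.Nonempty) :
    ∃ x k, 0 < k ∧ x + k ≤ n ∧ s = II n x k := by
  obtain ⟨a, ha, hamin⟩ := s.exists_min_image id s.toFinite h2
  obtain ⟨b, hb, hbmax⟩ := s.exists_max_image id s.toFinite h2
  have hab : a.val ≤ b.val := hamin b hb
  have hb2 := b.2
  refine ⟨a, b + 1 - a, by omega, by omega, ?_⟩
  apply Set.Subset.antisymm
  · intro x hx
    have h3 : a.val ≤ x.val := hamin x hx
    have h4 : x.val ≤ b.val := hbmax x hx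
    exact ⟨h3, by omega⟩
  · rintro x ⟨h3, h4⟩
    refine h1.out ha hb ⟨h3, ?_⟩
    rw [Fin.le_def]; omega

lemma II_inj {x k x' k' : ℕ} (hk : 0 < k) (hx : x + k ≤ n) (hk' : 0 < k') (hx' : x' + k' ≤ n)
    (h : II n x k = II n x' k') : x = x' ∧ k = k' := by
  have e : k = k' := by rw [← II_card hx, ← II_card hx', h]
  refine ⟨?_, e⟩
  have h1 : (⟨x, by omega⟩ : Fin n) ∈ II n x' k' := by rw [← h]; exact ⟨le_rfl, by simp; omega⟩
  have h2 : (⟨x', by omega⟩ : Fin n) ∈ II n x k := by rw [h]; exact ⟨le_rfl, by simp; omega⟩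
  have h3 := h1.1
  have h4 := h2.1
  simp only at h3 h4
  omega

lemma sif_card {α : Type*} [LinearOrder α] [Finite α] : sif α = sif (Fin (Nat.card α)) := by
  have := Fintype.ofFinite α
  exact sif_fin (Nat.card_eq_fintype_card).symm

lemma gp_card {α : Type*} [LinearOrder α] [Finite α] [Nonempty α] :
    gp α = sif (Fin (Nat.card α + 1)) := by
  have : Finite (WithTop α) := inferInstanceAs (Finite (Option α))
  rw [gp_eq, sif_card]
  have : Nat.card (WithTop α) = Nat.card α + 1 := Finite.card_option
  rw [this]

theorem sif_rec (m : ℕ) : sif (Fin (m + 2)) = (m + 1) * sif (Fin (m + 1)) +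
    ∑ j ∈ Finset.Icc 2 m, (j - 1) * sif (Fin j) * sif (Fin (m + 2 - j)) := by
  classical
  have h1 := gp_rec (α := Fin (m + 1))
  rw [gp_card, Nat.card_eq_fintype_card, Fintype.card_fin] at h1
  rw [h1]
  congr 1
  have h2 : ∀ K : {K : Set (Fin (m + 1)) // Mid K},
      gp {x // x ∈ K.1} * sif {x // x ∉ K.1} =
      sif (Fin (Nat.card {x // x ∈ K.1} + 1)) *
        sif (Fin (m + 1 - Nat.card {x // x ∈ K.1})) := by
    rintro ⟨K, hK⟩
    have : Nonempty {x // x ∈ K} := hK.2.1.to_subtype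
    rw [gp_card, sif_card (α := {x // x ∉ K}), card_compl_sub]
  rw [Finset.sum_congr rfl (fun K _ => h2 K)]
  have h3 : ∀ j ∈ Finset.Icc 2 m, (j - 1) * sif (Fin j) * sif (Fin (m + 2 - j)) =
      ∑ x ∈ Finset.range (j - 1), sif (Fin j) * sif (Fin (m + 2 - j)) := by
    intro j _
    rw [Finset.sum_const, Finset.card_range, smul_eq_mul, mul_assoc]
  rw [Finset.sum_congr rfl h3, Finset.sum_sigma']
  symm
  refine Finset.sum_bij (fun p hp => ⟨II (m + 1) (p.2 + 1) (m + 1 - p.1), ?_⟩) ?_ ?_ ?_ ?_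
  · simp only [Finset.mem_sigma, Finset.mem_Icc, Finset.mem_range] at hp
    obtain ⟨⟨h4, h5⟩, h6⟩ := hp
    refine ⟨II_ord _ _, ⟨⟨p.2 + 1, by omega⟩, ⟨le_rfl, by simp; omega⟩⟩, ?_, ?_⟩
    · rintro ⟨h7, h8⟩
      have : (⊥ : Fin (m + 1)).val = 0 := rfl
      omega
    · rintro ⟨h7, h8⟩
      simp [Fin.top_eq_last] at h8
      omega
  · intro p hp
    exact Finset.mem_univ _
  · intro p hp q hq h
    simp only [Finset.mem_sigma, Finset.mem_Icc, Finset.mem_range] at hp hq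
    have h4 := congrArg Subtype.val h
    have h5 := II_inj (by omega) (by omega) (by omega) (by omega) h4
    obtain ⟨j, x⟩ := p
    obtain ⟨j', x'⟩ := q
    simp only at h5 hp hq
    obtain rfl : j = j' := by omega
    obtain rfl : x = x' := by omega
    rfl
  · rintro ⟨K, hK⟩ _
    obtain ⟨x, k, h4, h5, rfl⟩ := exists_II hK.1 hK.2.1
    have h6 : 0 < x := by
      by_contra hc
      apply hK.2.2.1
      have : (⊥ : Fin (m + 1)).val = 0 := rfl
      exact ⟨by omega, by omega⟩
    have h7 : x + k < m + 1 := by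
      by_contra hc
      apply hK.2.2.2
      refine ⟨?_, ?_⟩ <;> simp [Fin.top_eq_last] <;> omega
    refine ⟨⟨m + 1 - k, x - 1⟩, ?_, ?_⟩
    · simp only [Finset.mem_sigma, Finset.mem_Icc, Finset.mem_range]
      omega
    · apply Subtype.ext
      simp only
      congr 1 <;> omega
  · intro p hp
    simp only [Finset.mem_sigma, Finset.mem_Icc, Finset.mem_range] at hp
    simp only
    rw [II_card (by omega), mul_comm, show m + 1 - p.1 + 1 = m + 2 - p.1 by omega,
      show m + 1 - (m + 1 - p.1) = p.1 by omega]

end Pos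

namespace Pos

variable {n : ℕ}

lemma sif_derangement (hn : 2 ≤ n) {σ : Equiv.Perm (Fin n)} (h : SIF σ) : σ ∈ derangements (Fin n) := by
  intro x hx
  have h1 := h {x} Set.ordConnected_singleton ⟨x, rfl⟩ (by rintro y rfl; exact hx)
  have : Nontrivial (Fin n) := Fin.nontrivial_iff_two_le.2 hn
  obtain ⟨y, hy⟩ := exists_ne x
  have h2 : y ∈ ({x} : Set (Fin n)) := by rw [h1]; trivial
  exact hy h2

open Classical in
lemma card_stable {x k : ℕ} (h : x + k ≤ n) :
    #{σ : Equiv.Perm (Fin n) | ∀ z ∈ II n x k, σ z ∈ II n x k} ≤ k.factorial * (n - k).factorial := by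
  set s := II n x k with hs
  have h1 : ({σ : Equiv.Perm (Fin n) | ∀ z ∈ s, σ z ∈ s} : Finset _) ⊆
      (Finset.univ : Finset (Equiv.Perm {z // z ∈ s} × Equiv.Perm {z // z ∉ s})).image
        (fun p => Equiv.Perm.subtypeCongr p.1 p.2) := by
    intro σ hσ
    simp only [Finset.mem_filter, Finset.mem_univ, true_and] at hσ
    have hiff : ∀ x, σ x ∈ s ↔ x ∈ s := fun x =>
      ⟨fun hx => by by_contra hc; exact stable_compl σ hσ hc hx, hσ x⟩
    rw [Finset.mem_image]
    refine ⟨(σ.subtypePerm hiff, σ.subtypePerm (fun x => not_congr (hiff x))), Finset.mem_univ _, ?_⟩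
    ext x
    by_cases hx : x ∈ s
    · rw [Equiv.Perm.subtypeCongr.left_apply _ _ hx]; rfl
    · rw [Equiv.Perm.subtypeCongr.right_apply _ _ hx]; rfl
  refine (Finset.card_le_card h1).trans (Finset.card_image_le.trans ?_)
  rw [Finset.card_univ, Fintype.card_prod, Fintype.card_perm, Fintype.card_perm,
    ← Nat.card_eq_fintype_card, ← Nat.card_eq_fintype_card, card_compl_sub, hs, II_card h]

lemma sif_eq_card [DecidablePred (SIF (α := Fin n))] :
    sif (Fin n) = #{σ : Equiv.Perm (Fin n) | SIF σ} := by
  unfold sif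
  rw [Nat.card_eq_fintype_card, Fintype.card_subtype]

lemma der_eq_card [DecidablePred (fun σ : Equiv.Perm (Fin n) => σ ∈ derangements (Fin n))] :
    numDerangements n = #{σ : Equiv.Perm (Fin n) | σ ∈ derangements (Fin n)} := by
  classical
  rw [← card_derangements_fin_eq_numDerangements, ← Fintype.card_subtype]

lemma sif_le (hn : 2 ≤ n) : sif (Fin n) ≤ numDerangements n := by
  classical
  rw [sif_eq_card, der_eq_card]
  apply Finset.card_le_card
  intro σ hσ
  simp only [Finset.mem_filter, Finset.mem_univ, true_and] at hσ ⊢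
  exact sif_derangement hn hσ

lemma der_le : numDerangements n ≤ sif (Fin n) +
    ∑ k ∈ Finset.Icc 2 (n - 2), n * (k.factorial * (n - k).factorial) := by
  classical
  rw [sif_eq_card, der_eq_card]
  have h1 : ({σ : Equiv.Perm (Fin n) | σ ∈ derangements (Fin n)} : Finset _) ⊆
      ({σ : Equiv.Perm (Fin n) | SIF σ} : Finset _) ∪ (Finset.Icc 2 (n - 2)).biUnion fun k =>
        (Finset.range (n + 1 - k)).biUnion fun x =>
          ({σ : Equiv.Perm (Fin n) | ∀ z ∈ II n x k, σ z ∈ II n x k} : Finset _) := by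
    intro σ hσ
    simp only [Finset.mem_filter, Finset.mem_univ, true_and] at hσ
    rw [Finset.mem_union]
    by_cases hS : SIF σ
    · left; simpa using hS
    right
    unfold SIF at hS
    push Not at hS
    obtain ⟨s, h1, h2, h3, h4⟩ := hS
    obtain ⟨x, k, hk, hxk, rfl⟩ := exists_II h1 h2
    have hk1 : k ≠ 1 := by
      rintro rfl
      have h5 : (⟨x, by omega⟩ : Fin n) ∈ II n x 1 := ⟨le_rfl, by simp⟩
      have h6 := h3 _ h5
      refine hσ ⟨x, by omega⟩ ?_
      apply Fin.ext
      have h7 := h6.1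
      have h8 := h6.2
      simp only
      omega
    have hkn : k ≠ n := by
      rintro rfl
      apply h4
      ext z
      have := z.2
      simp only [Set.mem_univ, iff_true]
      exact ⟨by omega, by omega⟩
    have hkn1 : k ≠ n - 1 := by
      intro hkn1
      have h5 : ∃ y : Fin n, ∀ z, z ∉ II n x k ↔ z = y := by
        by_cases hx : x = 0
        · refine ⟨⟨n - 1, by omega⟩, fun z => ?_⟩
          have := z.2
          simp only [II, Set.mem_ofPred_eq, Fin.ext_iff]
          omega
        · refine ⟨⟨0, by omega⟩, fun z => ?_⟩
          have := z.2
          simp only [II, Set.mem_ofPred_eq, Fin.ext_iff]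
          omega
      obtain ⟨y, hy⟩ := h5
      have h6 := stable_compl σ h3 ((hy y).2 rfl)
      exact hσ y ((hy _).1 h6)
    simp only [Finset.mem_biUnion, Finset.mem_Icc, Finset.mem_range, Finset.mem_filter,
      Finset.mem_univ, true_and]
    exact ⟨k, by omega, x, by omega, h3⟩
  refine (Finset.card_le_card h1).trans ((Finset.card_union_le _ _).trans ?_)
  refine Nat.add_le_add_left ?_ _
  refine Finset.card_biUnion_le.trans (Finset.sum_le_sum fun k hk => ?_)
  rw [Finset.mem_Icc] at hk
  refine Finset.card_biUnion_le.trans ?_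
  refine (Finset.sum_le_sum fun x hx => ?_ :
    _ ≤ ∑ x ∈ Finset.range (n + 1 - k), k.factorial * (n - k).factorial).trans ?_
  · rw [Finset.mem_range] at hx
    convert card_stable (n := n) (x := x) (k := k) (by omega)
  · rw [Finset.sum_const, Finset.card_range, smul_eq_mul]
    exact Nat.mul_le_mul_right _ (by omega)

lemma fact_bd (p q : ℕ) :
    (p + 3).factorial * (q + 3).factorial ≤ 6 * (p + q + 3).factorial := by
  induction p with
  | zero => simp [Nat.factorial]
  | succ p ih =>
    rw [show p + 1 + 3 = (p + 3) + 1 by ring, show p + 1 + q + 3 = (p + q + 3) + 1 by ring,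
      Nat.factorial_succ (p + 3), Nat.factorial_succ (p + q + 3)]
    calc (p + 3 + 1) * (p + 3).factorial * (q + 3).factorial
        = (p + 3 + 1) * ((p + 3).factorial * (q + 3).factorial) := by ring
      _ ≤ (p + q + 3 + 1) * (6 * (p + q + 3).factorial) := Nat.mul_le_mul (by omega) ih
      _ = _ := by ring

lemma err_bd (m : ℕ) :
    (∑ k ∈ Finset.Icc 2 (m + 3 - 2), (m + 3) * (k.factorial * (m + 3 - k).factorial)) * (m + 1) ≤
      16 * (m + 3).factorial := by
  have h1 : ∀ k ∈ Finset.Icc 2 (m + 3 - 2), (m + 3) * (k.factorial * (m + 3 - k).factorial) ≤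
      (m + 3) * (6 * m.factorial + (if k = 2 then 2 * (m + 1).factorial else 0) +
        (if k = m + 1 then 2 * (m + 1).factorial else 0)) := by
    intro k hk
    rw [Finset.mem_Icc] at hk
    refine Nat.mul_le_mul_left _ ?_
    by_cases h2 : k = 2
    · subst h2
      rw [if_pos rfl, show m + 3 - 2 = m + 1 by omega]
      simp only [Nat.factorial_two]
      omega
    by_cases h3 : k = m + 1
    · subst h3
      rw [if_pos rfl, show m + 3 - (m + 1) = 2 by omega]
      simp only [Nat.factorial_two]
      omega
    · obtain ⟨p, rfl⟩ : ∃ p, k = p + 3 := ⟨k - 3, by omega⟩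
      obtain ⟨q, rfl⟩ : ∃ q, m = p + q + 3 := ⟨m - p - 3, by omega⟩
      have := fact_bd p q
      rw [show p + q + 3 + 3 - (p + 3) = q + 3 by omega]
      omega
  have h2 := Finset.sum_le_sum h1
  rw [← Finset.mul_sum, ← Finset.mul_sum, Finset.sum_add_distrib, Finset.sum_add_distrib, Finset.sum_ite_eq',
    Finset.sum_ite_eq', Finset.sum_const, Nat.card_Icc, smul_eq_mul] at h2
  rw [← Finset.mul_sum]
  refine (Nat.mul_le_mul_right _ h2).trans ?_
  have h3 : (m + 3 - 2 + 1 - 2) * (6 * m.factorial) +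
      (if 2 ∈ Finset.Icc 2 (m + 3 - 2) then 2 * (m + 1).factorial else 0) +
      (if m + 1 ∈ Finset.Icc 2 (m + 3 - 2) then 2 * (m + 1).factorial else 0) ≤
      m * (6 * m.factorial) + 4 * (m + 1).factorial := by
    rw [show m + 3 - 2 + 1 - 2 = m by omega]
    split_ifs <;> omega
  refine (Nat.mul_le_mul_right _ (Nat.mul_le_mul_left _ h3)).trans ?_
  simp only [Nat.factorial_succ]
  have : 0 < m.factorial := Nat.factorial_pos m
  calc (m + 3) * (m * (6 * m.factorial) + 4 * ((m + 1) * m.factorial)) * (m + 1)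
      = (m + 3) * (m + 1) * m.factorial * (10 * m + 4) := by ring
    _ ≤ (m + 3) * (m + 1) * m.factorial * (16 * (m + 2)) := Nat.mul_le_mul_left _ (by omega)
    _ = _ := by ring

lemma sif_lim : Filter.Tendsto (fun n : ℕ => (sif (Fin n) : ℝ) / (n.factorial : ℝ))
      Filter.atTop (nhds (1 / Real.exp 1)) := by
  have h0 : Real.exp (-1) = 1 / Real.exp 1 := by rw [Real.exp_neg, one_div]
  have hD := numDerangements_tendsto_inv_e
  rw [h0] at hD
  rw [← Filter.tendsto_add_atTop_iff_nat 3] at hD ⊢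
  have hL : Filter.Tendsto (fun m : ℕ => (numDerangements (m + 3) : ℝ) / ((m + 3).factorial : ℝ)
      - 16 * (1 / ((m : ℝ) + 1))) Filter.atTop (nhds (1 / Real.exp 1)) := by
    have := hD.sub ((tendsto_one_div_add_atTop_nhds_zero_nat (𝕜 := ℝ)).const_mul 16)
    simpa using this
  refine tendsto_of_tendsto_of_tendsto_of_le_of_le hL hD ?_ ?_
  · intro m
    have hf : (0 : ℝ) < ((m + 3).factorial : ℝ) := by exact_mod_cast Nat.factorial_pos _
    have hm : (0 : ℝ) < (m : ℝ) + 1 := by positivity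
    have h1 := der_le (n := m + 3)
    have h2 := err_bd m
    generalize (∑ k ∈ Finset.Icc 2 (m + 3 - 2), (m + 3) * (k.factorial * (m + 3 - k).factorial)) = E
      at h1 h2
    have h1' : (numDerangements (m + 3) : ℝ) ≤ sif (Fin (m + 3)) + E := by exact_mod_cast h1
    have h2' : (E : ℝ) * ((m : ℝ) + 1) ≤ 16 * ((m + 3).factorial : ℝ) := by exact_mod_cast h2
    have h3 : (E : ℝ) / ((m + 3).factorial : ℝ) ≤ 16 * (1 / ((m : ℝ) + 1)) := by
      rw [mul_one_div, div_le_div_iff₀ hf hm]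
      exact h2'
    have h4 : (numDerangements (m + 3) : ℝ) / ((m + 3).factorial : ℝ) ≤
        sif (Fin (m + 3)) / ((m + 3).factorial : ℝ) + E / ((m + 3).factorial : ℝ) := by
      rw [← add_div]
      exact div_le_div_of_nonneg_right h1' hf.le
    simp only
    linarith
  · intro m
    have h1 := sif_le (n := m + 3) (by omega)
    simp only
    gcongr

end Pos

namespace Pos

lemma sif_two : sif (Fin 2) = 1 := by
  have h := sif_rec 0
  simp only [Nat.zero_add, one_mul] at h
  rw [h]
  have : sif (Fin 1) = 1 := by
    unfold sif
    rw [Nat.card_eq_one_iff_unique]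
    refine ⟨⟨fun a b => Subtype.ext (Subsingleton.elim _ _)⟩, ⟨1, ?_⟩⟩
    intro s _ h2 _
    obtain ⟨x, hx⟩ := h2
    rw [Set.eq_univ_iff_forall]
    intro y
    rwa [Subsingleton.elim y x]
  rw [this]
  simp

lemma conn_one (P : Finset (Fin 1) → Prop) : MatroidConnected P := by
  rintro ⟨E₁, E₂, _, _, ⟨x, hx⟩, ⟨y, hy⟩, h, _⟩
  rw [Subsingleton.elim y x] at hy
  exact Finset.disjoint_left.1 h hx hy

lemma sub_one (B : Finset (Fin 1)) : B = ∅ ∨ B = {0} := by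
  revert B; decide

lemma pos_one (ℬ : Finset (Finset (Fin 1))) :
    IsPositroid (fun B => B ∈ ℬ) ↔ ℬ = {∅} ∨ ℬ = {{0}} := by
  constructor
  · rintro ⟨d, A, ⟨h1, h2⟩, h3⟩
    have hd : d ≤ 1 := h1 ▸ A.rank_le_width
    have hc : ∀ B ∈ ℬ, B.card = d := fun B hB => ((h3 B).1 hB).1
    interval_cases d
    · left
      ext B
      rw [Finset.mem_singleton]
      constructor
      · intro hB
        exact Finset.card_eq_zero.1 (hc B hB)
      · rintro rfl
        exact (h3 ∅).2 ⟨rfl, linearIndependent_empty_type⟩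
    · right
      ext B
      rw [Finset.mem_singleton]
      constructor
      · intro hB
        rcases sub_one B with rfl | rfl
        · have := hc _ hB
          simp at this
        · rfl
      · rintro rfl
        refine (h3 {0}).2 ⟨rfl, ?_⟩
        have hne : (fun i => A i 0) ≠ 0 := by
          intro h0
          have : A = 0 := by
            ext i j
            rw [Subsingleton.elim j 0]
            exact congrFun h0 i
          rw [this, Matrix.rank_zero] at h1
          omega
        have hsub : Subsingleton {x // x ∈ ({0} : Finset (Fin 1))} := inferInstance
        have : Unique {x // x ∈ ({0} : Finset (Fin 1))} :=
          ⟨⟨⟨0, by simp⟩⟩, fun a => Subsingleton.elim _ _⟩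
        refine LinearIndependent.of_subsingleton (⟨0, by simp⟩ : {x // x ∈ ({0} : Finset (Fin 1))}) ?_
        exact hne
  · rintro (rfl | rfl)
    · refine ⟨0, 0, ⟨?_, ?_⟩, ?_⟩
      · simp
      · intro f _
        simp
      · intro B
        beta_reduce
        rw [Finset.mem_singleton, Finset.card_eq_zero]
        constructor
        · rintro rfl
          exact ⟨rfl, linearIndependent_empty_type⟩
        · exact fun h => h.1
    · refine ⟨1, 1, ⟨?_, ?_⟩, ?_⟩
      · simp
      · intro f _
        rw [Subsingleton.elim f id]
        simp
      · intro B
        beta_reduce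
        rw [Finset.mem_singleton]
        constructor
        · rintro rfl
          refine ⟨rfl, ?_⟩
          refine LinearIndependent.of_subsingleton
            (⟨0, by simp⟩ : {x // x ∈ ({0} : Finset (Fin 1))}) ?_
          intro h
          have := congrFun h 0
          simp at this
        · rintro ⟨h, _⟩
          rcases sub_one B with rfl | rfl
          · simp at h
          · rfl

lemma numConn_one : numConnPositroids 1 = 2 := by
  unfold numConnPositroids
  have : ∀ ℬ : Finset (Finset (Fin 1)),
      (IsPositroid (fun B => B ∈ ℬ) ∧ MatroidConnected (fun B => B ∈ ℬ)) ↔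
        ℬ ∈ ({{∅}, {{0}}} : Finset (Finset (Finset (Fin 1)))) := by
    intro ℬ
    rw [pos_one, Finset.mem_insert, Finset.mem_singleton]
    exact and_iff_left (conn_one _)
  rw [Nat.card_congr (Equiv.subtypeEquivRight this), Nat.card_eq_fintype_card, Fintype.card_coe]
  decide

theorem main :
    numConnPositroids 1 = 2 ∧ numConnPositroids 2 = 1 ∧
    (∀ n : ℕ, 3 ≤ n →
      numConnPositroids n =
        (n - 1) * numConnPositroids (n - 1) +
          ∑ j ∈ Finset.Icc 2 (n - 2), (j - 1) * numConnPositroids j * numConnPositroids (n - j)) ∧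
    Filter.Tendsto (fun n : ℕ => (numConnPositroids n : ℝ) / (n.factorial : ℝ))
      Filter.atTop (nhds (1 / Real.exp 1)) := by
  refine ⟨numConn_one, ?_, ?_, ?_⟩
  · rw [numConn_eq_sif le_rfl, sif_two]
  · intro n hn
    obtain ⟨m, rfl⟩ : ∃ m, n = m + 2 := ⟨n - 2, by omega⟩
    rw [numConn_eq_sif (by omega), sif_rec, show m + 2 - 1 = m + 1 by omega,
      show m + 2 - 2 = m by omega, numConn_eq_sif (n := m + 1) (by omega)]
    congr 1
    refine Finset.sum_congr rfl fun j hj => ?_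
    rw [Finset.mem_Icc] at hj
    rw [numConn_eq_sif (n := j) (by omega), numConn_eq_sif (n := m + 2 - j) (by omega)]
  · refine sif_lim.congr' ?_
    filter_upwards [Filter.eventually_ge_atTop 2] with n hn
    rw [numConn_eq_sif hn]

end Pos

/-- Let `p_c(n)` be the number of connected positroids on
`[n]` (so `p_c(1) = 2` and `p_c(2) = 1`).  Then for every `n ≥ 3`,
`p_c(n) = (n-1)·p_c(n-1) + Σ_{j=2}^{n-2} (j-1)·p_c(j)·p_c(n-j)`, and
`p_c(n)/n! → 1/e` as `n → ∞`. -/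
theorem numConnPositroids_recurrence_and_limit :
    numConnPositroids 1 = 2 ∧ numConnPositroids 2 = 1 ∧
    (∀ n : ℕ, 3 ≤ n →
      numConnPositroids n =
        (n - 1) * numConnPositroids (n - 1) +
          ∑ j ∈ Finset.Icc 2 (n - 2), (j - 1) * numConnPositroids j * numConnPositroids (n - j)) ∧
    Filter.Tendsto (fun n : ℕ => (numConnPositroids n : ℝ) / (n.factorial : ℝ))
      Filter.atTop (nhds (1 / Real.exp 1)) := by
  exact Pos.main
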